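/- For every integer n ≥ 1 there exists a bijection τ on the set of partitions of n such that for every partition λ of n: crank(λ) − rank(τ(λ)) = 0 if crank(λ) = 0; crank(λ) − rank(τ(λ)) ∈ {0, 1} if crank(λ) > 0; and crank(λ) − rank(τ(λ)) ∈ {0, −1} if crank(λ) < 0. -/

import Mathlib

open scoped BigOperators

namespace RankCrank

/-- The `i`-th largest part of a partition (1-indexed); `0` if `i` exceeds
the number of parts. -/
def part {n : ℕ} (l : n.Partition) (i : ℕ) : ℕ :=
  ((l.parts.sort (· ≤ ·)).reverse).getD (i - 1) 0

/-- The rank of a partition: largest part minus number of parts. -/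
def rank {n : ℕ} (l : n.Partition) : ℤ :=
  (part l 1 : ℤ) - l.parts.card

/-- The crank of a partition: the largest part if there are no parts equal to 1,
otherwise the number of parts larger than the number of 1's minus the number of 1's. -/
def crank {n : ℕ} (l : n.Partition) : ℤ :=
  if l.parts.count 1 = 0 then (part l 1 : ℤ)
  else ((l.parts.filter (fun x => l.parts.count 1 < x)).card : ℤ) - l.parts.count 1

/-- `N m n` is the number of partitions of `n` with rank `m`. -/
noncomputable def N (m : ℤ) (n : ℕ) : ℕ :=
  Nat.card {l : n.Partition // rank l = m}

/-- `M m n` is the number of partitions of `n` with crank `m` for `n ≠ 1`, with the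
usual convention for `n = 1`. -/
noncomputable def M (m : ℤ) (n : ℕ) : ℤ :=
  if n = 1 then (if m = 0 then -1 else if m = 1 ∨ m = -1 then 1 else 0)
  else (Nat.card {l : n.Partition // crank l = m} : ℤ)

/-- `Nle m n = N(≤ m, n) = ∑_{r ≤ m} N(r,n)`; since `N(r,n) = 0` for `r < -n`,
the sum may be taken over `-n ≤ r ≤ m`. -/
noncomputable def Nle (m : ℤ) (n : ℕ) : ℤ :=
  ∑ r ∈ Finset.Icc (-(n : ℤ)) m, (N r n : ℤ)

/-- `Mle m n = M(≤ m, n) = ∑_{r ≤ m} M(r,n)`; since `M(r,n) = 0` for `r < -n`,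
the sum may be taken over `-n ≤ r ≤ m`. -/
noncomputable def Mle (m : ℤ) (n : ℕ) : ℤ :=
  ∑ r ∈ Finset.Icc (-(n : ℤ)) m, M r n

/-- The number of partitions of `n`. -/
noncomputable def p (n : ℕ) : ℕ := Nat.card n.Partition

/-- `ospt n = ∑_{m ≥ 0} m M(m,n) - ∑_{m ≥ 0} m N(m,n)`; since ranks and cranks of
partitions of `n` are at most `n`, the sums may be taken over `0 ≤ m ≤ n`. -/
noncomputable def ospt (n : ℕ) : ℤ :=
  (∑ m ∈ Finset.Icc (0 : ℤ) (n : ℤ), m * M m n) -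
    (∑ m ∈ Finset.Icc (0 : ℤ) (n : ℤ), m * (N m n : ℤ))

/-- The rank-set of a partition `λ`:  `{j - λ_{j+1} : 0 ≤ j ≤ ℓ-1} ∪ {j : j ≥ ℓ}`
(note `part l (j+1) = 0` for `j ≥ ℓ`). -/
def rankSet {n : ℕ} (l : n.Partition) : Set ℤ :=
  {x | ∃ j : ℕ, x = (j : ℤ) - (part l (j + 1) : ℤ)}

/-- `q m n` is the number of partitions of `n` whose rank-set contains `m`. -/
noncomputable def q (m : ℤ) (n : ℕ) : ℕ :=
  Nat.card {l : n.Partition // m ∈ rankSet l}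

/-- `prank m n` is the number of partitions of `n` with rank at least `m`. -/
noncomputable def prank (m : ℤ) (n : ℕ) : ℕ :=
  Nat.card {l : n.Partition // m ≤ rank l}

/-- `jm m l` is the number of columns of the `m`-Durfee rectangle of `l`: the largest
`j ≥ 0` with `λ_{m+j} ≥ j`. -/
noncomputable def jm {n : ℕ} (m : ℕ) (l : n.Partition) : ℕ :=
  sSup {j : ℕ | j ≤ part l (m + j)}

/-- The total number of smallest parts in all partitions of `n`. -/
def spt (n : ℕ) : ℕ :=
  ∑ l : n.Partition, l.parts.count ((l.parts.sort (· ≤ ·)).headD 0)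

/-- A bijection `τ` on partitions of `n` nearly preserves the rank–crank
distribution if `crank λ - rank (τ λ)` is `0` when `crank λ = 0`, is `0` or `1`
when `crank λ > 0`, and is `0` or `-1` when `crank λ < 0`. -/
def NearlyPreserves {n : ℕ} (τ : n.Partition ≃ n.Partition) : Prop :=
  ∀ l : n.Partition,
    (crank l = 0 → crank l - rank (τ l) = 0) ∧
    (0 < crank l → crank l - rank (τ l) = 0 ∨ crank l - rank (τ l) = 1) ∧
    (crank l < 0 → crank l - rank (τ l) = 0 ∨ crank l - rank (τ l) = -1)

end RankCrank

namespace QSeries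

open PowerSeries Finset.HasAntidiagonal

/-- A power series with integer coefficients is nonnegative if all its coefficients are. -/
def Nonneg (f : ℤ⟦X⟧) : Prop := ∀ n, 0 ≤ coeff n f

namespace Nonneg

theorem zero : Nonneg 0 := fun n => by simp

theorem one : Nonneg 1 := fun n => by
  rw [coeff_one]; split_ifs <;> simp

theorem add {f g : ℤ⟦X⟧} (hf : Nonneg f) (hg : Nonneg g) : Nonneg (f + g) := fun n => by
  rw [map_add]; exact add_nonneg (hf n) (hg n)

theorem mul {f g : ℤ⟦X⟧} (hf : Nonneg f) (hg : Nonneg g) : Nonneg (f * g) := fun n => by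
  rw [coeff_mul]; exact Finset.sum_nonneg fun p _ => mul_nonneg (hf _) (hg _)

theorem pow_X (k : ℕ) : Nonneg (X ^ k) := fun n => by
  rw [coeff_X_pow]; split_ifs <;> simp

theorem X_mul (k : ℕ) {f : ℤ⟦X⟧} (hf : Nonneg f) : Nonneg (X ^ k * f) := (pow_X k).mul hf

theorem trans {f g h : ℤ⟦X⟧} (h₁ : Nonneg (g - f)) (h₂ : Nonneg (h - g)) : Nonneg (h - f) := by
  have := h₁.add h₂
  rwa [sub_add_sub_cancel'] at this

end Nonneg

/-- Gaussian binomial coefficients as power series. -/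
noncomputable def gauss : ℕ → ℕ → ℤ⟦X⟧
  | _, 0 => 1
  | 0, _ + 1 => 0
  | n + 1, k + 1 => gauss n k + X ^ (k + 1) * gauss n (k + 1)

theorem gauss_zero_right (n : ℕ) : gauss n 0 = 1 := by cases n <;> rfl

theorem gauss_succ (n k : ℕ) :
    gauss (n + 1) (k + 1) = gauss n k + X ^ (k + 1) * gauss n (k + 1) := rfl

theorem gauss_eq_zero {n k : ℕ} (h : n < k) : gauss n k = 0 := by
  induction n generalizing k with
  | zero => obtain ⟨k, rfl⟩ := Nat.exists_eq_succ_of_ne_zero (by omega : k ≠ 0); rfl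
  | succ n ih =>
    obtain ⟨k, rfl⟩ := Nat.exists_eq_succ_of_ne_zero (by omega : k ≠ 0)
    rw [Nat.succ_eq_add_one, gauss_succ, ih (by omega), ih (by omega)]; simp

/-- The generating function of the partitions with at most `k` parts, all at most `p`. -/
noncomputable def box (p k : ℕ) : ℤ⟦X⟧ := gauss (p + k) k

theorem box_zero_right (p : ℕ) : box p 0 = 1 := gauss_zero_right _

theorem box_zero_left (k : ℕ) : box 0 k = 1 := by
  unfold box
  induction k with
  | zero => rfl
  | succ k ih =>
    rw [← add_assoc, gauss_succ, ih, gauss_eq_zero (by omega)]; simp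

theorem box_succ' (p k : ℕ) :
    box (p + 1) (k + 1) = box (p + 1) k + X ^ (k + 1) * box p (k + 1) := by
  unfold box
  rw [show p + 1 + (k + 1) = (p + 1 + k) + 1 by ring, gauss_succ,
    show p + 1 + k = p + (k + 1) by ring]

theorem box_comm (p k : ℕ) : box p k = box k p ∧
    box (p + 1) (k + 1) = box p (k + 1) + X ^ (p + 1) * box (p + 1) k := by
  induction hs : p + k using Nat.strong_induction_on generalizing p k with
  | _ s ih =>
    have comm : ∀ p k, p + k ≤ s → box p k = box k p := by
      intro p k h
      rcases p with _ | p
      · rw [box_zero_left, box_zero_right]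
      rcases k with _ | k
      · rw [box_zero_left, box_zero_right]
      rw [(ih (p + k) (by omega) p k rfl).2, box_succ',
        (ih (p + (k + 1)) (by omega) p (k + 1) rfl).1,
        (ih (p + 1 + k) (by omega) (p + 1) k rfl).1]
    refine ⟨comm p k hs.le, ?_⟩
    rcases p with _ | p
    · rcases k with _ | k
      · rw [box_succ']; simp [box_zero_left, box_zero_right]
      · rw [box_succ']
        have h1 := (ih k (by omega) 0 k (by simp)).2
        have h2 := box_succ' 0 k
        simp only [zero_add, box_zero_left] at h1 h2 ⊢
        linear_combination h1 - X * h2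
    · rcases k with _ | k
      · rw [box_succ', box_succ' p 0]
        have h1 := (ih p (by omega) p 0 (by simp)).2
        have h2 := box_succ' p 0
        simp only [zero_add, box_zero_right] at h1 h2 ⊢
        linear_combination X * (h1 - h2) + h2 - h2
      · have h1 := (ih (p + (k + 1)) (by omega) p (k + 1) rfl).2
        have h2 := (ih (p + 1 + k) (by omega) (p + 1) k rfl).2
        have h3 := box_succ' (p + 1) (k + 1)
        have h4 := box_succ' p (k + 1)
        have h5 := box_succ' (p + 1) k
        rw [h3]
        linear_combination X ^ (k + 2) * h1 + h2 - h4 - X ^ (p + 2) * h5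

theorem box_symm (p k : ℕ) : box p k = box k p := (box_comm p k).1

theorem box_succ (p k : ℕ) :
    box (p + 1) (k + 1) = box p (k + 1) + X ^ (p + 1) * box (p + 1) k := (box_comm p k).2

theorem nonneg_gauss (n k : ℕ) : Nonneg (gauss n k) := by
  induction n generalizing k with
  | zero => cases k with
    | zero => exact .one
    | succ k => exact .zero
  | succ n ih => cases k with
    | zero => exact .one
    | succ k => exact (ih k).add ((ih _).X_mul _)

theorem nonneg_box (p k : ℕ) : Nonneg (box p k) := nonneg_gauss _ _

theorem box_le_succ_left (p k : ℕ) : Nonneg (box (p + 1) k - box p k) := by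
  rcases k with _ | k
  · simpa [box_zero_right] using Nonneg.zero
  · rw [box_succ, add_sub_cancel_left]; exact (nonneg_box _ _).X_mul _

theorem box_le_left {p p' : ℕ} (h : p ≤ p') (k : ℕ) : Nonneg (box p' k - box p k) := by
  induction h with
  | refl => simpa using Nonneg.zero
  | step _ ih => exact ih.trans (box_le_succ_left _ _)

theorem box_le_right (p : ℕ) {k k' : ℕ} (h : k ≤ k') : Nonneg (box p k' - box p k) := by
  rw [box_symm p, box_symm p]; exact box_le_left h p

/-- Adding a part `s` to a partition. -/
theorem X_pow_mul_box_le {s p : ℕ} (h : s ≤ p) (k : ℕ) :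
    Nonneg (box p (k + 1) - X ^ s * box p k) := by
  rcases s with _ | s
  · simpa using box_le_right p (Nat.le_succ k)
  · induction h generalizing k with
    | refl => rw [box_succ, add_sub_cancel_right]; exact nonneg_box _ _
    | @step p h ih =>
      induction k with
      | zero =>
        have h2 := ih 0
        rw [box_zero_right] at h2 ⊢
        have := h2.add (box_le_succ_left p (0 + 1))
        rwa [sub_add_sub_cancel'] at this
      | succ k ihk =>
        have e : box (p + 1) (k + 1 + 1) - X ^ (s + 1) * box (p + 1) (k + 1)
            = (box p (k + 1 + 1) - X ^ (s + 1) * box p (k + 1))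
              + X ^ (p + 1) * (box (p + 1) (k + 1) - X ^ (s + 1) * box (p + 1) k) := by
          rw [box_succ p (k + 1), box_succ p k]; ring
        rw [Nat.succ_eq_add_one, e]
        exact (ih (k + 1)).add (ihk.X_mul _)

theorem box_mul_succ_of_log_concave {c : ℕ}
    (hA : ∀ x u t, Nonneg (box (x + u) c * box (x + t) c - box x c * box (x + u + t) c))
    (x u t : ℕ) :
    Nonneg (box (x + u) (c + 1) * box (x + t) c - box x (c + 1) * box (x + u + t) c) := by
  induction x generalizing u t with
  | zero =>
    have h := (hA 0 u t).add
      ((box_le_right (0 + u) (Nat.le_succ c)).mul (nonneg_box (0 + t) c))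
    convert h using 1
    rw [box_zero_left, box_zero_left]; ring
  | succ x ih =>
    have h := (hA (x + 1) u t).add ((ih u (t + 1)).X_mul (c + 1))
    convert h using 1
    rw [show x + 1 + u = x + u + 1 by ring, box_succ' (x + u), box_succ' x,
      show x + 1 + t = x + (t + 1) by ring, show x + u + 1 + t = x + u + (t + 1) by ring]
    ring

/-- Gaussian binomial coefficients are log-concave. -/
theorem box_log_concave (c x u t : ℕ) :
    Nonneg (box (x + u) c * box (x + t) c - box x c * box (x + u + t) c) := by
  induction c generalizing x u t with
  | zero => simpa [box_zero_right] using Nonneg.zero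
  | succ c ih =>
    have step : ∀ a t, Nonneg (box (a + 1) (c + 1) * box (a + t) (c + 1)
        - box a (c + 1) * box (a + t + 1) (c + 1)) := by
      intro a t
      convert box_mul_succ_of_log_concave ih a t 1 using 1
      rw [box_succ' a, box_succ' (a + t)]; ring
    induction u generalizing x t with
    | zero => simpa using Nonneg.zero
    | succ u ihu =>
      rcases t with _ | t
      · convert Nonneg.zero using 1
        simp only [add_zero]; ring
      · have h := (step x (u + t + 1)).add (ihu (x + 1) t)
        convert h using 1
        rw [show x + (u + 1) + (t + 1) = x + (u + t + 1) + 1 by ring,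
          show x + (u + 1) = x + 1 + u by ring, show x + (t + 1) = x + 1 + t by ring,
          show x + (u + t + 1) = x + 1 + u + t by ring]
        ring

theorem box_mul_succ_le (c x u t : ℕ) :
    Nonneg (box (x + u) (c + 1) * box (x + t) c - box x (c + 1) * box (x + u + t) c) :=
  box_mul_succ_of_log_concave (box_log_concave c) x u t

/-- The sum of a sequence of power series whose `i`-th term is divisible by `X ^ i`. -/
noncomputable def ser (f : ℕ → ℤ⟦X⟧) : ℤ⟦X⟧ :=
  mk fun n => ∑ i ∈ Finset.range (n + 1), coeff n (f i)

/-- The sum of a double sequence of power series whose term of index `i, k` is divisible by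
`X ^ (i + k)`. -/
noncomputable def ser2 (F : ℕ → ℕ → ℤ⟦X⟧) : ℤ⟦X⟧ := ser fun i => ser (F i)

/-- The condition for `ser f` to be the sum of `f`. -/
def Adm (f : ℕ → ℤ⟦X⟧) : Prop := ∀ i, X ^ i ∣ f i

/-- The condition for `ser2 F` to be the sum of `F`. -/
def Adm2 (F : ℕ → ℕ → ℤ⟦X⟧) : Prop := ∀ i k, X ^ (i + k) ∣ F i k

theorem adm_X_pow {e : ℕ → ℕ} (h : ∀ i, i ≤ e i) (g : ℕ → ℤ⟦X⟧) :
    Adm fun i => X ^ e i * g i :=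
  fun i => Dvd.dvd.mul_right (pow_dvd_pow X (h i)) _

theorem adm2_X_pow {e : ℕ → ℕ → ℕ} (h : ∀ i k, i + k ≤ e i k) (g : ℕ → ℕ → ℤ⟦X⟧) :
    Adm2 fun i k => X ^ e i k * g i k :=
  fun i k => Dvd.dvd.mul_right (pow_dvd_pow X (h i k)) _

theorem Adm.coeff_eq_zero {f : ℕ → ℤ⟦X⟧} (h : Adm f) {i n : ℕ} (hn : n < i) :
    coeff n (f i) = 0 := X_pow_dvd_iff.1 (h i) n hn

theorem Adm2.row {F : ℕ → ℕ → ℤ⟦X⟧} (h : Adm2 F) (i : ℕ) : Adm (F i) :=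
  fun k => (pow_dvd_pow X (Nat.le_add_left k i)).trans (h i k)

theorem Adm2.col {F : ℕ → ℕ → ℤ⟦X⟧} (h : Adm2 F) (k : ℕ) : Adm fun i => F i k :=
  fun i => (pow_dvd_pow X (Nat.le_add_right i k)).trans (h i k)

theorem Adm2.succ_left {F : ℕ → ℕ → ℤ⟦X⟧} (h : Adm2 F) : Adm2 fun i k => F (i + 1) k :=
  fun i k => (pow_dvd_pow X (by omega)).trans (h (i + 1) k)

theorem Adm2.succ_right {F : ℕ → ℕ → ℤ⟦X⟧} (h : Adm2 F) : Adm2 fun i k => F i (k + 1) :=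
  fun i k => (pow_dvd_pow X (by omega)).trans (h i (k + 1))

theorem coeff_ser (f : ℕ → ℤ⟦X⟧) (n : ℕ) :
    coeff n (ser f) = ∑ i ∈ Finset.range (n + 1), coeff n (f i) := coeff_mk _ _

theorem coeff_ser_of_lt {f : ℕ → ℤ⟦X⟧} (h : Adm f) {n N : ℕ} (hn : n < N) :
    coeff n (ser f) = ∑ i ∈ Finset.range N, coeff n (f i) := by
  rw [coeff_ser]
  refine Finset.sum_subset (Finset.range_mono hn) fun i _ hi => h.coeff_eq_zero ?_
  simp only [Finset.mem_range, not_lt] at hi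
  omega

theorem X_pow_dvd_ser {f : ℕ → ℤ⟦X⟧} {m : ℕ} (h : ∀ i, X ^ m ∣ f i) : X ^ m ∣ ser f := by
  rw [X_pow_dvd_iff]
  intro n hn
  rw [coeff_ser]
  exact Finset.sum_eq_zero fun i _ => X_pow_dvd_iff.1 (h i) n hn

theorem Adm2.adm_ser {F : ℕ → ℕ → ℤ⟦X⟧} (h : Adm2 F) : Adm fun i => ser (F i) :=
  fun i => X_pow_dvd_ser (h.col · i)

theorem ser_add (f g : ℕ → ℤ⟦X⟧) : (ser fun i => f i + g i) = ser f + ser g := by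
  ext n; simp [coeff_ser, Finset.sum_add_distrib]

theorem ser_sub (f g : ℕ → ℤ⟦X⟧) : (ser fun i => f i - g i) = ser f - ser g := by
  ext n; simp [coeff_ser, Finset.sum_sub_distrib]

theorem ser2_add (F G : ℕ → ℕ → ℤ⟦X⟧) : (ser2 fun i k => F i k + G i k) = ser2 F + ser2 G := by
  simp only [ser2, ser_add]

theorem ser2_sub (F G : ℕ → ℕ → ℤ⟦X⟧) : (ser2 fun i k => F i k - G i k) = ser2 F - ser2 G := by
  simp only [ser2, ser_sub]

theorem ser_mul_left {f : ℕ → ℤ⟦X⟧} (h : Adm f) (g : ℤ⟦X⟧) :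
    (ser fun i => g * f i) = g * ser f := by
  ext n
  rw [coeff_ser, coeff_mul]
  simp only [coeff_mul]
  rw [Finset.sum_comm]
  refine Finset.sum_congr rfl fun p hp => ?_
  rw [coeff_ser_of_lt h (N := n + 1), Finset.mul_sum]
  have := mem_antidiagonal.1 hp
  omega

theorem ser_eq_add {f : ℕ → ℤ⟦X⟧} (h : Adm f) : ser f = f 0 + ser fun i => f (i + 1) := by
  ext n
  rw [map_add, coeff_ser_of_lt h (N := n + 2) (by omega), coeff_ser, Finset.sum_range_succ',
    add_comm]

theorem ser_telescope {b : ℕ → ℤ⟦X⟧} (h : Adm b) : (ser fun i => b i - b (i + 1)) = b 0 := by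
  rw [ser_sub, ser_eq_add h]; ring

theorem ser2_eq_row {F : ℕ → ℕ → ℤ⟦X⟧} (h : Adm2 F) :
    ser2 F = ser (F 0) + ser2 fun i k => F (i + 1) k := ser_eq_add h.adm_ser

theorem ser2_eq_col {F : ℕ → ℕ → ℤ⟦X⟧} (h : Adm2 F) :
    ser2 F = (ser fun i => F i 0) + ser2 fun i k => F i (k + 1) := by
  unfold ser2
  rw [← ser_add]
  congr 1; funext i
  exact ser_eq_add (h.row i)

theorem ser_antidiagonal {F : ℕ → ℕ → ℤ⟦X⟧} (h : Adm2 F) :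
    (ser fun r => ∑ p ∈ antidiagonal r, F p.1 p.2) = ser2 F := by
  ext n
  simp only [ser2, coeff_ser, map_sum]
  rw [← Finset.sum_product', Finset.sum_sigma']
  refine Finset.sum_bij_ne_zero (fun x _ _ => x.2) ?_ ?_ ?_ ?_
  · rintro ⟨r, p⟩ hx -
    simp only [Finset.mem_sigma, Finset.mem_range, mem_antidiagonal,
      Finset.mem_product] at hx ⊢
    omega
  · rintro ⟨r, p⟩ hx - ⟨r', p'⟩ hx' - hp
    simp only [Finset.mem_sigma, Finset.mem_range, mem_antidiagonal] at hx hx' hp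
    obtain rfl := hp
    obtain rfl : r = r' := by omega
    rfl
  · rintro ⟨i, k⟩ hx hne
    refine ⟨⟨i + k, (i, k)⟩, ?_, hne, rfl⟩
    simp only [Finset.mem_sigma, Finset.mem_range, mem_antidiagonal, and_true]
    by_contra hlt
    exact hne (X_pow_dvd_iff.1 (h i k) n (by omega))
  · rintro ⟨r, p⟩ _ _
    rfl

theorem nonneg_ser {f : ℕ → ℤ⟦X⟧} (h : ∀ i, Nonneg (f i)) : Nonneg (ser f) := fun n => by
  rw [coeff_ser]; exact Finset.sum_nonneg fun i _ => h i n

theorem nonneg_ser2 {F : ℕ → ℕ → ℤ⟦X⟧} (h : ∀ i k, Nonneg (F i k)) : Nonneg (ser2 F) :=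
  nonneg_ser fun i => nonneg_ser (h i)

theorem nonneg_ser_sub {f g : ℕ → ℤ⟦X⟧} (h : ∀ i, Nonneg (f i - g i)) :
    Nonneg (ser f - ser g) := by
  rw [← ser_sub]; exact nonneg_ser h

theorem nonneg_ser2_sub {F G : ℕ → ℕ → ℤ⟦X⟧} (h : ∀ i k, Nonneg (F i k - G i k)) :
    Nonneg (ser2 F - ser2 G) := by
  rw [← ser2_sub]; exact nonneg_ser2 h

theorem sum_antidiagonal_gauss (M R s : ℕ) :
    ∑ p ∈ antidiagonal R, X ^ (p.1 * (p.1 + s)) * gauss M p.1 * gauss (R + s) p.2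
      = gauss (M + R + s) R := by
  induction M generalizing s with
  | zero =>
    rw [Finset.sum_eq_single (0, R)]
    · simp [gauss_zero_right]
    · rintro ⟨i, k⟩ h hne
      have hi : 0 < i := by
        rcases Nat.eq_zero_or_pos i with rfl | h'
        · simp_all
        · exact h'
      simp [gauss_eq_zero hi]
    · simp
  | succ M ih =>
    rw [show M + 1 + R + s = M + R + (s + 1) by ring, ← ih (s + 1)]
    rcases R with _ | R
    · simp [gauss_zero_right]
    · trans (∑ p ∈ antidiagonal (R + 1),
          X ^ (p.1 * (p.1 + (s + 1))) * gauss M p.1 * gauss (R + 1 + s) p.2)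
          + ∑ p ∈ antidiagonal R,
            X ^ ((p.1 + 1) * (p.1 + 1 + s)) * gauss M p.1 * gauss (R + 1 + s) p.2
      · rw [Finset.Nat.sum_antidiagonal_succ, Finset.Nat.sum_antidiagonal_succ, add_assoc (G := ℤ⟦X⟧),
          ← Finset.sum_add_distrib]
        congr 1
        · simp [gauss_zero_right]
        · refine Finset.sum_congr rfl fun p _ => ?_
          rw [gauss_succ]; ring
      · rw [Finset.Nat.sum_antidiagonal_succ', Finset.Nat.sum_antidiagonal_succ', add_assoc (G := ℤ⟦X⟧),
          ← Finset.sum_add_distrib]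
        congr 1
        · simp [gauss_zero_right]
        · refine Finset.sum_congr rfl fun p hp => ?_
          have hp := mem_antidiagonal.1 hp
          have h := box_succ (p.1 + s) p.2
          unfold box at h
          rw [show p.1 + s + 1 + (p.2 + 1) = R + 1 + (s + 1) by omega,
            show p.1 + s + (p.2 + 1) = R + 1 + s by omega,
            show p.1 + s + 1 + p.2 = R + 1 + s by omega] at h
          rw [h]; ring

theorem box_add_eq_sum (r s : ℕ) :
    box (r + s) r = ∑ p ∈ antidiagonal r,
      X ^ (p.1 * (p.1 + s)) * box p.1 p.2 * box (p.1 + s) p.2 := by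
  have h := sum_antidiagonal_gauss r r s
  unfold box
  rw [show r + s + r = r + r + s by ring, ← h]
  refine Finset.sum_congr rfl fun p hp => ?_
  have hp := mem_antidiagonal.1 hp
  have h1 : gauss r p.1 = gauss (p.1 + p.2) p.2 := by
    rw [← hp, show p.1 + p.2 = p.2 + p.1 by ring]
    exact (box_symm p.2 p.1).trans (by unfold box; rw [add_comm])
  rw [h1, ← hp, show p.1 + s + p.2 = p.1 + p.2 + s by ring]

/-- The generating function of the partitions of rank at least `m`. -/
noncomputable def rankSer (m : ℕ) : ℤ⟦X⟧ := ser fun r => X ^ (m + 1 + r) * box (m + 1 + r) r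

theorem rankSer_eq (m : ℕ) :
    rankSer m = ser2 fun i k =>
      X ^ ((i + 1) * (i + m + 1) + k) * (box i k * box (i + m + 1) k) := by
  rw [← ser_antidiagonal (adm2_X_pow (fun i k => by nlinarith) _)]
  unfold rankSer
  congr 1; funext r
  rw [show m + 1 + r = r + (m + 1) by ring, box_add_eq_sum, Finset.mul_sum]
  refine Finset.sum_congr rfl fun p hp => ?_
  have hp := mem_antidiagonal.1 hp
  rw [← hp]; ring_nf

theorem coeff_box_stable {p k n : ℕ} (h : n ≤ k) : coeff n (box p k) = coeff n (box p n) := by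
  induction h with
  | refl => rfl
  | @step k h ih =>
    rw [← ih]
    rcases p with _ | p
    · rw [box_zero_left, box_zero_left]
    · rw [Nat.succ_eq_add_one, box_succ', map_add, coeff_X_pow_mul', if_neg (by simp at h; omega), add_zero]

/-- The generating function of the partitions with all parts at most `d`. -/
noncomputable def bdd (d : ℕ) : ℤ⟦X⟧ := mk fun n => coeff n (box d n)

theorem coeff_bdd {d k n : ℕ} (h : n ≤ k) : coeff n (bdd d) = coeff n (box d k) := by
  rw [bdd, coeff_mk, coeff_box_stable h]

theorem bdd_zero : bdd 0 = 1 := by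
  ext n; rw [bdd, coeff_mk, box_zero_left]

theorem bdd_succ (d : ℕ) : bdd (d + 1) = bdd d + X ^ (d + 1) * bdd (d + 1) := by
  ext n
  rw [map_add, coeff_bdd (Nat.le_succ n), box_succ, map_add, coeff_bdd (Nat.le_succ n),
    coeff_X_pow_mul', coeff_X_pow_mul']
  split_ifs
  · rw [coeff_bdd (Nat.sub_le n (d + 1))]
  · rfl

theorem bdd_mul_bdd (d e : ℕ) :
    bdd d * bdd e = 1 + ser fun k => box d (k + 1) * box e (k + 1) - box d k * box e k := by
  ext n
  rw [map_add, coeff_ser, ← map_sum, Finset.sum_range_sub (fun k => box d k * box e k),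
    box_zero_right, box_zero_right, mul_one, ← map_add, add_sub_cancel, coeff_mul, coeff_mul]
  refine Finset.sum_congr rfl fun p hp => ?_
  have hp := mem_antidiagonal.1 hp
  rw [coeff_bdd (k := n + 1) (by omega), coeff_bdd (k := n + 1) (by omega)]

theorem bdd_eq_ser (e : ℕ) : bdd (e + 1) = ser fun k => X ^ k * box e k := by
  have h := bdd_mul_bdd 0 (e + 1)
  rw [bdd_zero, one_mul] at h
  rw [h, ser_eq_add (adm_X_pow (fun _ => le_rfl) _)]
  simp only [box_zero_left, box_succ', box_zero_right]
  simp

theorem bdd_mul_bdd_eq_ser (d e : ℕ) :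
    bdd (d + 1) * bdd (e + 1) = (ser fun k => X ^ k * (box e k * box (d + 1) k))
      + ser fun k => X ^ (k + 1) * (box d (k + 1) * box (e + 1) k) := by
  rw [bdd_mul_bdd, ser_eq_add (adm_X_pow (fun _ => le_rfl) _), add_assoc, ← ser_add]
  congr 1
  · simp [box_zero_right]
  · congr 1; funext k
    rw [box_succ' e, box_succ' d]; ring

/-- The generating function of the partitions of crank at least `m`, for `m ≥ 1`. -/
noncomputable def crankSer (m : ℕ) : ℤ⟦X⟧ :=
  ser fun d => X ^ ((d + 1) * (d + m)) * (bdd d * bdd (d + m))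

theorem crankSer_eq (M : ℕ) :
    crankSer (M + 1) =
      (ser2 fun i k => X ^ ((i + 1) * (i + M + 1) + k) * (box (i + M) k * box i k))
      + ser2 fun i k => X ^ ((i + 2) * (i + M + 2) + k + 1) * (box i (k + 1) * box (i + M + 2) k)
      := by
  have a1 : ∀ d, Adm fun k => X ^ k * (box (d + M) k * box d k) :=
    fun d => adm_X_pow (fun _ => le_rfl) _
  have a2 : ∀ d, Adm fun k => X ^ (k + 1) * (box d (k + 1) * box (d + M + 2) k) :=
    fun d => adm_X_pow (fun _ => Nat.le_succ _) _
  rw [ser2_eq_row (adm2_X_pow (fun i k => by nlinarith) _), crankSer,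
    ser_eq_add (adm_X_pow (fun d => by nlinarith) _), add_assoc]
  congr 1
  · rw [bdd_zero, one_mul, show 0 + (M + 1) = M + 1 by ring, bdd_eq_ser,
      ← ser_mul_left (adm_X_pow (fun _ => le_rfl) _)]
    congr 1; funext k
    rw [box_zero_left]; ring_nf
  · rw [ser2, ser2, ← ser_add]
    congr 1; funext d
    rw [show d + 1 + (M + 1) = d + 1 + M + 1 by ring, bdd_mul_bdd_eq_ser, mul_add,
      ← ser_mul_left (a1 (d + 1)), show d + 1 + M + 1 = d + M + 2 by ring, ← ser_mul_left (a2 d)]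
    congr 1
    · congr 1; funext k; ring
    · congr 1; funext k; ring

theorem crankSer_sub_rankSer (M : ℕ) :
    crankSer (M + 1) - rankSer (M + 1) = X ^ (M + 1)
      + (ser2 fun i k => X ^ ((i + 1) * (i + M + 2) + k)
          * (box i k * (box (i + M) (k + 1) - box (i + M) k)))
      - ser2 fun i k => X ^ ((i + 3) * (i + M + 3) + 2 * k + 1)
          * (box (i + M + 2) k * box i (k + 1)) := by
  have hP : rankSer (M + 1)
      = (ser2 fun i k => X ^ ((i + 1) * (i + M + 2) + k) * (box i k * box (i + M + 1) k))
      + ser2 fun i k => X ^ ((i + 2) * (i + M + 2) + k + 1)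
        * (box i (k + 1) * box (i + M + 2) k) := by
    rw [rankSer_eq, ser2_eq_col (adm2_X_pow (fun i k => by nlinarith) _),
      ser2_eq_col (F := fun i k => X ^ ((i + 1) * (i + M + 2) + k) * _)
        (adm2_X_pow (fun i k => by nlinarith) _), add_assoc, ← ser2_add]
    congr 1; congr 1; funext i k
    rw [show i + (M + 1) + 1 = i + M + 1 + 1 by ring, box_succ (i + M + 1)]
    ring
  have hT : (ser2 fun i k => X ^ ((i + 1) * (i + M + 1) + k) * (box (i + M) k * box i k))
      = X ^ (M + 1)
        + (ser2 fun i k => X ^ ((i + 2) * (i + M + 2) + k) * (box (i + M + 1) k * box i k))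
        + ser2 fun i k => X ^ ((i + 1) * (i + M + 2) + k) * (box (i + M) (k + 1) * box i k) := by
    have b0 : Adm2 fun i k => X ^ ((i + 1) * (i + M + 1) + k) * (box (i + M) k * box i k) :=
      adm2_X_pow (fun i k => by nlinarith) _
    rw [ser2_eq_row b0, ser_eq_add (b0.row 0), ser2_eq_col b0.succ_left,
      ser2_eq_col (F := fun i k => X ^ ((i + 2) * (i + M + 2) + k) * _)
        (adm2_X_pow (fun i k => by nlinarith) _),
      ser2_eq_row (F := fun i k => X ^ ((i + 1) * (i + M + 2) + k) * (box (i + M) (k + 1) * _))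
        (adm2_X_pow (fun i k => by nlinarith) _)]
    have e1 : (ser2 fun i k => X ^ ((i + 1 + 1) * (i + 1 + M + 1) + (k + 1))
          * (box (i + 1 + M) (k + 1) * box (i + 1) (k + 1)))
        = (ser2 fun i k => X ^ ((i + 2) * (i + M + 2) + (k + 1))
          * (box (i + M + 1) (k + 1) * box i (k + 1)))
        + ser2 fun i k => X ^ ((i + 1 + 1) * (i + 1 + M + 2) + k)
          * (box (i + 1 + M) (k + 1) * box (i + 1) k) := by
      rw [← ser2_add]; congr 1; funext i k
      rw [box_succ i k, show i + 1 + M = i + M + 1 by ring]; ring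
    have e2 : (ser fun i => X ^ ((i + 1 + 1) * (i + 1 + M + 1) + 0)
          * (box (i + 1 + M) 0 * box (i + 1) 0))
        = ser fun i => X ^ ((i + 2) * (i + M + 2) + 0) * (box (i + M + 1) 0 * box i 0) := by
      congr 1; funext i
      simp only [box_zero_right]; ring_nf
    have e3 : (ser fun k => X ^ ((0 + 1) * (0 + M + 1) + (k + 1))
          * (box (0 + M) (k + 1) * box 0 (k + 1)))
        = ser fun k => X ^ ((0 + 1) * (0 + M + 2) + k) * (box (0 + M) (k + 1) * box 0 k) := by
      congr 1; funext k
      simp only [box_zero_left]; ring_nf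
    have e4 : X ^ ((0 + 1) * (0 + M + 1) + 0) * (box (0 + M) 0 * box 0 0)
        = (X : ℤ⟦X⟧) ^ (M + 1) := by
      simp only [box_zero_right]; ring_nf
    rw [e1, e2, e3, e4]; ring
  have hA : (ser2 fun i k => X ^ ((i + 1) * (i + M + 2) + k)
          * (box i k * (box (i + M + 1) k - box (i + M) k)))
      = ser2 fun i k => X ^ ((i + 2) * (i + M + 2) + k) * (box i (k + 1) * box (i + M + 1) k) := by
    rw [ser2_eq_col (adm2_X_pow (fun i k => by nlinarith) _)]
    have e : (ser fun i => X ^ ((i + 1) * (i + M + 2) + 0)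
          * (box i 0 * (box (i + M + 1) 0 - box (i + M) 0))) = 0 := by
      ext n; simp [coeff_ser, box_zero_right]
    rw [e, zero_add]; congr 1; funext i k
    rw [box_succ (i + M)]; ring
  have hN : (ser2 fun i k => X ^ ((i + 2) * (i + M + 2) + k)
        * (box (i + M + 1) k * (box i (k + 1) - box i k)))
      = ser2 fun i k => X ^ ((i + 3) * (i + M + 3) + 2 * k + 1)
          * (box (i + M + 2) k * box i (k + 1)) := by
    rw [ser2_eq_row (adm2_X_pow (fun i k => by nlinarith) _)]
    have e : (ser fun k => X ^ ((0 + 2) * (0 + M + 2) + k)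
        * (box (0 + M + 1) k * (box 0 (k + 1) - box 0 k))) = 0 := by
      ext n; simp [coeff_ser, box_zero_left]
    rw [e, zero_add]; congr 1; funext i k
    rw [box_succ' i, show i + 1 + M + 1 = i + M + 2 by ring]; ring
  have hS := ser2_sub (fun i k => X ^ ((i + 1) * (i + M + 2) + k) * (box (i + M) (k + 1) * box i k))
    (fun i k => X ^ ((i + 1) * (i + M + 2) + k) * (box i k * box (i + M + 1) k))
  have hS' : (ser2 fun i k => X ^ ((i + 1) * (i + M + 2) + k) * (box (i + M) (k + 1) * box i k)
        - X ^ ((i + 1) * (i + M + 2) + k) * (box i k * box (i + M + 1) k))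
      = (ser2 fun i k => X ^ ((i + 1) * (i + M + 2) + k)
          * (box i k * (box (i + M) (k + 1) - box (i + M) k)))
        - ser2 fun i k => X ^ ((i + 1) * (i + M + 2) + k)
          * (box i k * (box (i + M + 1) k - box (i + M) k)) := by
    rw [← ser2_sub]; congr 1; funext i k; ring
  have hN' : (ser2 fun i k => X ^ ((i + 2) * (i + M + 2) + k)
        * (box (i + M + 1) k * (box i (k + 1) - box i k)))
      = (ser2 fun i k => X ^ ((i + 2) * (i + M + 2) + k) * (box i (k + 1) * box (i + M + 1) k))
        - ser2 fun i k => X ^ ((i + 2) * (i + M + 2) + k) * (box (i + M + 1) k * box i k) := by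
    rw [← ser2_sub]; congr 1; funext i k; ring
  rw [crankSer_eq, hP, hT, ← hN, hN', ← hA]
  linear_combination hS' - hS

theorem Nonneg.sub_mul_left {f g h : ℤ⟦X⟧} (h₁ : Nonneg (g - f)) (h₂ : Nonneg h) :
    Nonneg (h * g - h * f) := by
  rw [← mul_sub]; exact h₂.mul h₁

theorem nonneg_ser2_sub_succ_left {F : ℕ → ℕ → ℤ⟦X⟧} (h : Adm2 F) (hF : ∀ i k, Nonneg (F i k)) :
    Nonneg (ser2 F - ser2 fun i k => F (i + 1) k) := by
  rw [ser2_eq_row h, add_sub_cancel_right]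
  exact nonneg_ser fun k => hF 0 k

theorem nonneg_ser2_sub_succ_right {F : ℕ → ℕ → ℤ⟦X⟧} (h : Adm2 F)
    (hF : ∀ i k, Nonneg (F i k)) : Nonneg (ser2 F - ser2 fun i k => F i (k + 1)) := by
  rw [ser2_eq_col h, add_sub_cancel_right]
  exact nonneg_ser fun i => hF i 0

theorem nonneg_crankSer_sub_rankSer_add_two (μ : ℕ) :
    Nonneg (crankSer (μ + 2) - rankSer (μ + 2)) := by
  have key1 : ∀ i k, Nonneg (box (i + 1) (k + 1) * box (i + 1 + μ) (k + 1)
      - X * (box i (k + 1) * box (i + μ + 2) k)) := by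
    intro i k
    have h1 := (X_pow_mul_box_le (s := 1) (p := i + μ + 2) (by omega) k).sub_mul_left
      (nonneg_box i (k + 1))
    have h2 := box_log_concave (k + 1) i 1 (μ + 1)
    convert h1.add h2 using 1
    rw [show i + 1 + (μ + 1) = i + μ + 2 by ring, show i + (μ + 1) = i + 1 + μ by ring]
    ring
  have key2 : ∀ i k, Nonneg (box (i + 2) (k + 1) * box (i + 1 + μ) (k + 2)
      - X ^ μ * (box i (k + 2) * box (i + μ + 3) k)) := by
    intro i k
    have h1 := (X_pow_mul_box_le (s := μ) (p := i + μ + 3) (by omega) k).sub_mul_left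
      (nonneg_box i (k + 2))
    have h2 := box_mul_succ_le (k + 1) i (μ + 1) 2
    convert h1.add h2 using 1
    rw [show i + (μ + 1) + 2 = i + μ + 3 by ring, show i + (μ + 1) = i + 1 + μ by ring]
    ring
  have hA : (ser2 fun i k => X ^ ((i + 1) * (i + (μ + 1) + 2) + k)
        * (box i k * (box (i + (μ + 1)) (k + 1) - box (i + (μ + 1)) k)))
      = (ser fun k => X ^ ((0 + 1) * (0 + (μ + 1) + 2) + k)
        * (box 0 k * (box (0 + (μ + 1)) (k + 1) - box (0 + (μ + 1)) k)))
      + (ser2 fun i k => X ^ ((i + 2) * (i + μ + 4) + 2 * k + i + μ + 2)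
        * (box (i + 1) k * box (i + 1 + μ) k))
      + ser2 fun i k => X ^ ((i + 2) * (i + μ + 4) + 2 * k + 1)
        * (box (i + 1) k * box (i + μ) (k + 1)) := by
    rw [ser2_eq_row (adm2_X_pow (fun i k => by nlinarith) _), add_assoc (G := ℤ⟦X⟧), ← ser2_add]
    congr 1; congr 1; funext i k
    rw [show i + 1 + (μ + 1) = i + μ + 1 + 1 by ring, box_succ' (i + μ + 1),
      show i + 1 + μ = i + μ + 1 by ring, box_succ (i + μ)]
    ring
  have hN : (ser2 fun i k => X ^ ((i + 3) * (i + (μ + 1) + 3) + 2 * k + 1)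
        * (box (i + (μ + 1) + 2) k * box i (k + 1)))
      = (ser2 fun i k => X ^ ((i + 3) * (i + μ + 4) + 2 * k + 1)
        * (box (i + μ + 2) k * box i (k + 1)))
      + ser2 fun i k => X ^ ((i + 3) * (i + μ + 4) + 2 * k + 3 + i + μ + 3)
        * (box (i + μ + 3) k * box i (k + 2)) := by
    rw [ser2_eq_col (adm2_X_pow (fun i k => by nlinarith) _),
      ser2_eq_col (F := fun i k => X ^ ((i + 3) * (i + μ + 4) + 2 * k + 1) * _)
        (adm2_X_pow (fun i k => by nlinarith) _), add_assoc, ← ser2_add]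
    congr 1; congr 1; funext i k
    rw [show i + (μ + 1) + 2 = i + μ + 2 + 1 by ring, box_succ (i + μ + 2)]
    ring
  have a1 : Adm2 fun i k => X ^ ((i + 2) * (i + μ + 4) + 2 * k + i + μ + 2)
      * (box (i + 1) k * box (i + 1 + μ) k) := adm2_X_pow (fun i k => by nlinarith) _
  have a2 : Adm2 fun i k => X ^ ((i + 2) * (i + μ + 4) + 2 * k + 1)
        * (box (i + 1) k * box (i + μ) (k + 1)) := adm2_X_pow (fun i k => by nlinarith) _
  have c1 := nonneg_ser2_sub_succ_right a1
    fun i k => ((nonneg_box (i + 1) k).mul (nonneg_box (i + 1 + μ) k)).X_mul _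
  have c2 := nonneg_ser2_sub_succ_left a2
    fun i k => ((nonneg_box (i + 1) k).mul (nonneg_box (i + μ) (k + 1))).X_mul _
  have c3 := nonneg_ser2_sub_succ_right a2.succ_left
    fun i k => ((nonneg_box (i + 1 + 1) k).mul (nonneg_box (i + 1 + μ) (k + 1))).X_mul _
  have d1 : Nonneg ((ser2 fun i k => X ^ ((i + 2) * (i + μ + 4) + 2 * (k + 1) + i + μ + 2)
        * (box (i + 1) (k + 1) * box (i + 1 + μ) (k + 1)))
      - ser2 fun i k => X ^ ((i + 3) * (i + μ + 4) + 2 * k + 1)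
        * (box (i + μ + 2) k * box i (k + 1))) := by
    refine nonneg_ser2_sub fun i k => ?_
    convert (key1 i k).X_mul ((i + 2) * (i + μ + 4) + 2 * (k + 1) + i + μ + 2) using 1
    ring
  have d2 : Nonneg ((ser2 fun i k => X ^ ((i + 1 + 2) * (i + 1 + μ + 4) + 2 * (k + 1) + 1)
        * (box (i + 1 + 1) (k + 1) * box (i + 1 + μ) (k + 1 + 1)))
      - ser2 fun i k => X ^ ((i + 3) * (i + μ + 4) + 2 * k + 3 + i + μ + 3)
        * (box (i + μ + 3) k * box i (k + 2))) := by
    refine nonneg_ser2_sub fun i k => ?_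
    convert (key2 i k).X_mul ((i + 1 + 2) * (i + 1 + μ + 4) + 2 * (k + 1) + 1) using 1
    ring
  have d0 : Nonneg (ser fun k => X ^ ((0 + 1) * (0 + (μ + 1) + 2) + k)
        * (box 0 k * (box (0 + (μ + 1)) (k + 1) - box (0 + (μ + 1)) k))) :=
    nonneg_ser fun k => ((nonneg_box 0 k).mul (box_le_right _ (Nat.le_succ k))).X_mul _
  rw [crankSer_sub_rankSer (μ + 1), hA, hN]
  convert (Nonneg.pow_X (μ + 1 + 1)).add (d0.add ((c1.add d1).add ((c2.add c3).add d2))) using 1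
  ring

/-- First differences, twisted by `X`, of the box generating functions. -/
noncomputable def gdiff (p : ℕ) : ℕ → ℤ⟦X⟧
  | 0 => 1
  | k + 1 => box p (k + 1) - X * box p k

theorem gdiff_zero (p : ℕ) : gdiff p 0 = 1 := rfl

theorem gdiff_succ (p k : ℕ) : gdiff p (k + 1) = box p (k + 1) - X * box p k := rfl

theorem gdiff_succ_succ (p k : ℕ) :
    gdiff (p + 1) (k + 1) = gdiff p (k + 1) + X ^ (p + 1) * gdiff (p + 1) k := by
  rw [gdiff_succ, gdiff_succ, box_succ]
  rcases k with _ | k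
  · simp only [box_zero_right, gdiff_zero]; ring
  · rw [gdiff_succ, box_succ p k]; ring

theorem gdiff_add_two_sub (p k : ℕ) :
    gdiff (p + 2) (k + 1) - gdiff (p + 2) k = X ^ (2 * (k + 1)) * box p (k + 1) := by
  rw [gdiff_succ, box_succ' (p + 1)]
  rcases k with _ | k
  · rw [gdiff_zero, box_zero_right, box_succ', box_zero_right]; ring
  · rw [gdiff_succ, box_succ' (p + 1) k, box_succ' p (k + 1)]; ring

theorem gdiff_one (k : ℕ) : gdiff 1 k = 1 := by
  rcases k with _ | k
  · rfl
  · have := box_succ 0 k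
    rw [box_zero_left, zero_add] at this
    rw [gdiff_succ, this]; ring

theorem gdiff_two_succ (k : ℕ) : gdiff 2 (k + 1) = 1 + X ^ 2 * gdiff 2 k := by
  rw [gdiff_succ_succ 1, gdiff_one]

theorem nonneg_gdiff (p k : ℕ) : Nonneg (gdiff (p + 1) k) := by
  rcases k with _ | k
  · exact .one
  · simpa [gdiff_succ] using X_pow_mul_box_le (s := 1) (p := p + 1) (by omega) k

theorem gdiff_le_box (p k : ℕ) : Nonneg (box p k - gdiff p k) := by
  rcases k with _ | k
  · simpa [box_zero_right, gdiff_zero] using Nonneg.zero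
  · rw [gdiff_succ, sub_sub_cancel]
    simpa using (nonneg_box p k).X_mul 1

theorem X_pow_mul_gdiff_le (p k : ℕ) :
    Nonneg (gdiff (p + 3) (k + 1) - X ^ 3 * gdiff (p + 3) k) := by
  induction p generalizing k with
  | zero =>
    rw [zero_add, gdiff_succ_succ 2, add_sub_cancel_right]; exact nonneg_gdiff 1 _
  | succ p ih =>
    induction k with
    | zero =>
      convert (ih 0).add (Nonneg.pow_X (p + 4)) using 1
      rw [show p + 1 + 3 = p + 3 + 1 by ring, gdiff_succ_succ (p + 3) 0]
      simp only [gdiff_zero]; ring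
    | succ k ihk =>
      convert (ih (k + 1)).add (ihk.X_mul (p + 4)) using 1
      rw [show p + 1 + 3 = p + 3 + 1 by ring, gdiff_succ_succ (p + 3) (k + 1),
        gdiff_succ_succ (p + 3) k]; ring

theorem nonneg_ser_sub_ser_X_pow :
    Nonneg ((ser fun l => X ^ (3 * l) * (1 + X + X ^ 2)) - ser fun l => X ^ (2 * l + 1) * 1) := by
  intro n
  have h1 : coeff n (X ^ (3 * (n / 3)) * (1 + X + X ^ 2) : ℤ⟦X⟧) = 1 := by
    rw [mul_add, mul_add, map_add, map_add, mul_one, ← pow_succ, ← pow_add, coeff_X_pow,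
      coeff_X_pow, coeff_X_pow]
    rcases (by omega : n = 3 * (n / 3) ∨ n = 3 * (n / 3) + 1 ∨ n = 3 * (n / 3) + 2)
      with h | h | h
    · rw [if_pos h, if_neg (by omega), if_neg (by omega)]; rfl
    · rw [if_neg (by omega), if_pos h, if_neg (by omega)]; rfl
    · rw [if_neg (by omega), if_neg (by omega), if_pos h]; rfl
  have h2 : 1 ≤ coeff n (ser fun l => X ^ (3 * l) * (1 + X + X ^ 2) : ℤ⟦X⟧) := by
    rw [coeff_ser, ← h1]
    refine Finset.single_le_sum
      (f := fun l => coeff n (X ^ (3 * l) * (1 + X + X ^ 2) : ℤ⟦X⟧)) (fun l _ => ?_) ?_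
    · refine Nonneg.X_mul (3 * l) (f := 1 + X + X ^ 2) ?_ n
      simpa using (Nonneg.one.add (Nonneg.pow_X 1)).add (Nonneg.pow_X 2)
    · simp only [Finset.mem_range]; omega
  have h3 : coeff n (ser fun l => X ^ (2 * l + 1) * 1 : ℤ⟦X⟧) ≤ 1 := by
    rw [coeff_ser]
    simp only [mul_one, coeff_X_pow]
    rw [Finset.sum_ite, Finset.sum_const_zero, add_zero, Finset.sum_const, nsmul_one]
    have : (Finset.filter (fun l => n = 2 * l + 1) (Finset.range (n + 1))).card ≤ 1 := by
      rw [Finset.card_le_one]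
      intro a ha b hb
      simp only [Finset.mem_filter] at ha hb
      omega
    exact_mod_cast this
  rw [map_sub]
  linarith

theorem X_pow_mul_le_gdiff_two (l : ℕ) :
    Nonneg ((1 + X + X ^ 2) * gdiff 2 (l + 1) - X ^ (l + 2) * (1 + X + X ^ 2)) := by
  have hT : Nonneg (1 + X + X ^ 2 : ℤ⟦X⟧) := by
    simpa using (Nonneg.one.add (Nonneg.pow_X 1)).add (Nonneg.pow_X 2)
  induction l using Nat.twoStepInduction with
  | zero =>
    convert hT using 1
    rw [gdiff_two_succ, gdiff_zero]; ring
  | one =>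
    convert ((((Nonneg.one.add (Nonneg.pow_X 1)).add (Nonneg.pow_X 2)).add
      (Nonneg.pow_X 2)).add (Nonneg.pow_X 4)).add (Nonneg.pow_X 6) using 1
    rw [gdiff_two_succ, gdiff_two_succ, gdiff_zero]; ring
  | more l ih _ =>
    have h := gdiff_add_two_sub 0 (l + 1)
    have hb := ((hT.mul (nonneg_box 0 (l + 1 + 1))).X_mul (2 * (l + 1 + 1))).X_mul 2
    convert (hT.add hb).add (ih.X_mul 2) using 1
    rw [zero_add] at h
    rw [gdiff_two_succ (l + 2)]
    linear_combination (1 + X + X ^ 2) * X ^ 2 * h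

/-- First part of the positive terms of `crankSer_sub_rankSer 0`. -/
noncomputable def posOne (i k : ℕ) : ℤ⟦X⟧ :=
  X ^ ((i + 2) * (i + 3) + 2 * k + 1 + i) * (box (i + 1) k * box i k)

/-- Second part of the positive terms of `crankSer_sub_rankSer 0`. -/
noncomputable def posTwo (i k : ℕ) : ℤ⟦X⟧ :=
  X ^ ((i + 3) * (i + 4) + 2 * k + 1) * (box (i + 2) k * box i (k + 1))

/-- First part of the negative terms of `crankSer_sub_rankSer 0`. -/
noncomputable def negOne (i k : ℕ) : ℤ⟦X⟧ :=
  X ^ ((i + 3) * (i + 3) + 2 * k + 1) * (box i (k + 1) * box (i + 1) k)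

/-- Second part of the negative terms of `crankSer_sub_rankSer 0`. -/
noncomputable def negTwo (i k : ℕ) : ℤ⟦X⟧ :=
  X ^ ((i + 3) * (i + 3) + 2 * k + i + 5) * (box i (k + 2) * box (i + 2) k)

/-- The terms of `ser2 posOne - ser2 negOne`. -/
noncomputable def diffOne (i k : ℕ) : ℤ⟦X⟧ :=
  X ^ ((i + 2) * (i + 3) + 2 * k + 1 + i) * (box i k * gdiff (i + 1) k)

/-- First negative part of the terms of `ser2 posTwo - ser2 negTwo`. -/
noncomputable def lossOne (i k : ℕ) : ℤ⟦X⟧ :=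
  X ^ ((i + 3) * (i + 3) + 2 * k + i + 5) * (box i (k + 1) * gdiff (i + 1) (k + 1))

/-- Second negative part of the terms of `ser2 posTwo - ser2 negTwo`. -/
noncomputable def lossTwo (i k : ℕ) : ℤ⟦X⟧ :=
  X ^ ((i + 3) * (i + 3) + 2 * k + 2 * i + 7) * (box i (k + 1) * gdiff (i + 2) k)

/-- Third negative part of the terms of `ser2 posTwo - ser2 negTwo`. -/
noncomputable def lossThree (i k : ℕ) : ℤ⟦X⟧ :=
  X ^ ((i + 4) * (i + 4) + 3 * k + i + 8) * (box i (k + 2) * gdiff (i + 3) (k + 1))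

/-- Positive part of the terms of `ser2 posTwo - ser2 negTwo`. -/
noncomputable def gain (i k : ℕ) : ℤ⟦X⟧ :=
  X ^ ((i + 3) * (i + 3) + 3 * k + i + 6) * ((1 + X) * (box i (k + 2) * box (i + 1) (k + 1)))

theorem adm2_posOne : Adm2 posOne := adm2_X_pow (fun i k => by nlinarith) _

theorem adm2_posTwo : Adm2 posTwo := adm2_X_pow (fun i k => by nlinarith) _

theorem adm2_negOne : Adm2 negOne := adm2_X_pow (fun i k => by nlinarith) _

theorem adm2_diffOne : Adm2 diffOne := adm2_X_pow (fun i k => by nlinarith) _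

theorem adm2_lossOne : Adm2 lossOne := adm2_X_pow (fun i k => by nlinarith) _

theorem adm2_lossTwo : Adm2 lossTwo := adm2_X_pow (fun i k => by nlinarith) _

theorem adm2_gain : Adm2 gain := adm2_X_pow (fun i k => by nlinarith) _

theorem ser2_eq_posOne_add_posTwo :
    (ser2 fun i k => X ^ ((i + 1) * (i + 0 + 2) + k)
      * (box i k * (box (i + 0) (k + 1) - box (i + 0) k))) = ser2 posOne + ser2 posTwo := by
  have e0 : (ser fun k => X ^ ((0 + 1) * (0 + 0 + 2) + k)
      * (box 0 k * (box (0 + 0) (k + 1) - box (0 + 0) k))) = 0 := by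
    ext n; simp [coeff_ser, box_zero_left]
  rw [ser2_eq_row (adm2_X_pow (fun i k => by nlinarith) _), e0, zero_add,
    ser2_eq_row (adm2_X_pow (fun i k => by nlinarith) _), ser2_eq_row adm2_posOne,
    add_assoc (G := ℤ⟦X⟧), ← ser2_add]
  refine congrArg₂ _ (congrArg ser (funext fun k => ?_))
    (congrArg ser2 (funext fun i => funext fun k => ?_))
  · have := box_succ' 0 k
    simp only [zero_add, box_zero_left] at this
    simp only [posOne, zero_add, box_zero_left, add_zero, this]; ring
  · simp only [posOne, posTwo]
    rw [show i + 1 + 1 + 0 = i + 1 + 1 by ring, box_succ' (i + 1), box_succ i]; ring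

theorem ser2_eq_negOne_add_negTwo :
    (ser2 fun i k => X ^ ((i + 3) * (i + 0 + 3) + 2 * k + 1)
      * (box (i + 0 + 2) k * box i (k + 1))) = ser2 negOne + ser2 negTwo := by
  rw [ser2_eq_col (adm2_X_pow (fun i k => by nlinarith) _), ser2_eq_col adm2_negOne,
    add_assoc (G := ℤ⟦X⟧), ← ser2_add]
  refine congrArg₂ _ (congrArg ser (funext fun i => ?_))
    (congrArg ser2 (funext fun i => funext fun k => ?_))
  · simp only [negOne, box_zero_right]; ring
  · simp only [negOne, negTwo]
    rw [show i + 0 + 2 = i + 1 + 1 by ring, box_succ (i + 1)]; ring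

theorem ser2_posOne_sub_negOne : ser2 posOne - ser2 negOne = ser2 diffOne := by
  rw [ser2_eq_col adm2_posOne, ser2_eq_col adm2_diffOne, add_sub_assoc, ← ser2_sub]
  refine congrArg₂ _ (congrArg ser (funext fun i => ?_))
    (congrArg ser2 (funext fun i => funext fun k => ?_))
  · simp only [posOne, diffOne, box_zero_right, gdiff_zero]
  · simp only [posOne, diffOne, negOne]
    rw [gdiff_succ]; ring

theorem ser2_lossThree : ser2 lossThree = ser2 fun i k => X ^ ((i + 3) * (i + 3) + 2 * k + i + 5)
    * ((box i (k + 2) - box i (k + 1)) * gdiff (i + 2) (k + 1)) := by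
  have e0 : (ser fun k => X ^ ((0 + 3) * (0 + 3) + 2 * k + 0 + 5)
      * ((box 0 (k + 2) - box 0 (k + 1)) * gdiff (0 + 2) (k + 1))) = 0 := by
    ext n; simp [coeff_ser, box_zero_left]
  rw [ser2_eq_row (F := fun i k => X ^ ((i + 3) * (i + 3) + 2 * k + i + 5) * _)
    (adm2_X_pow (fun i k => by nlinarith) _), e0, zero_add]
  refine congrArg ser2 (funext fun i => funext fun k => ?_)
  simp only [lossThree]
  rw [box_succ' i (k + 1)]; ring

theorem ser2_posTwo_sub_negTwo :
    ser2 posTwo - ser2 negTwo = (ser fun i => posTwo i 0)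
      + (ser2 gain - ser2 lossOne - ser2 lossTwo - ser2 lossThree) := by
  rw [ser2_lossThree, ser2_eq_col adm2_posTwo, add_sub_assoc,
    ← ser2_sub, ← ser2_sub, ← ser2_sub, ← ser2_sub]
  refine congrArg₂ _ rfl (congrArg ser2 (funext fun i => funext fun k => ?_))
  simp only [posTwo, negTwo, gain, lossOne, lossTwo]
  have h₁ : gdiff (i + 1) (k + 1) = gdiff (i + 2) (k + 1) - X ^ (i + 2) * gdiff (i + 2) k :=
    eq_sub_of_add_eq (gdiff_succ_succ (i + 1) k).symm
  have h₂ : X ^ (k + 1) * box (i + 1) (k + 1) = box (i + 2) (k + 1) - box (i + 2) k :=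
    eq_sub_of_add_eq' (box_succ' (i + 1) k).symm
  rw [h₁, gdiff_succ (i + 2) k]
  linear_combination (-X ^ ((i + 3) * (i + 3) + 2 * k + i + 5)) * (1 + X) * box i (k + 2) * h₂

theorem gain_sub_lossThree (j l : ℕ) :
    Nonneg (gain (j + 1) l - lossThree j l
      - X ^ ((j + 4) * (j + 4) + 3 * l + j + 7) * (box (j + 1) (l + 2) * box (j + 2) (l + 1))) := by
  have h₁ := box_mul_succ_le (l + 1) j 1 2
  have h₂ := (gdiff_le_box (j + 3) (l + 1)).sub_mul_left (nonneg_box j (l + 2))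
  convert (h₁.add h₂).X_mul ((j + 4) * (j + 4) + 3 * l + j + 8) using 1
  rw [gain, lossThree]
  ring

theorem diffOne_sub_loss (j l : ℕ) :
    diffOne (j + 1) (l + 2) - lossTwo j (l + 1) - lossOne (j + 1) l
      = X ^ ((j + 3) * (j + 4) + 2 * l + j + 6)
        * (X ^ (2 * (l + 2)) * (box j (l + 2) * box (j + 1) (l + 2))
          + X ^ (j + 1) * (box (j + 1) (l + 1) * gdiff (j + 2) (l + 1) * (1 - X ^ 3))) := by
  have h := eq_add_of_sub_eq (gdiff_add_two_sub j (l + 1))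
  have hb := box_succ j (l + 1)
  rw [diffOne, lossTwo, lossOne, show j + 1 + 1 = j + 2 by ring, h]
  linear_combination X ^ ((j + 3) * (j + 4) + 2 * l + j + 6) * gdiff (j + 2) (l + 1) * hb

theorem nonneg_diffOne_sub_loss_succ (i l : ℕ) :
    Nonneg (diffOne (i + 1 + 1) (l + 2) - lossTwo (i + 1) (l + 1) - lossOne (i + 1 + 1) l) := by
  have h₁ := (X_pow_mul_box_le (s := 1) (p := i + 1) (by omega) (l + 1)).sub_mul_left
    ((nonneg_box (i + 2) (l + 1)).X_mul (i + 2))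
  have h₂ := ((nonneg_box (i + 1) (l + 2)).mul (nonneg_box (i + 1) (l + 2))).add h₁
  have h₃ := ((X_pow_mul_gdiff_le i l).sub_mul_left
    ((nonneg_box (i + 2) (l + 1)).X_mul (i + 2)))
  rw [diffOne_sub_loss]
  refine Nonneg.X_mul _ ?_
  convert (h₂.X_mul (2 * (l + 2))).add h₃ using 1
  have h := eq_add_of_sub_eq (gdiff_add_two_sub (i + 1) l)
  have hb := box_succ (i + 1) (l + 1)
  rw [show i + 1 + 2 = i + 3 by ring] at h ⊢
  linear_combination X ^ (2 * (l + 2)) * box (i + 1) (l + 2) * hb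
    - X ^ 3 * X ^ (i + 2) * box (i + 2) (l + 1) * h

theorem nonneg_diffOne_sub_loss_zero (l : ℕ) :
    Nonneg (diffOne 1 (l + 2) - lossTwo 0 (l + 1) - lossOne 1 l
      + X ^ ((0 + 4) * (0 + 4) + 3 * l + 0 + 7) * (box 1 (l + 2) * box 2 (l + 1))) := by
  have hT : Nonneg (1 + X + X ^ 2 : ℤ⟦X⟧) := by
    simpa using (Nonneg.one.add (Nonneg.pow_X 1)).add (Nonneg.pow_X 2)
  have hone : ∀ k, (1 - X) * box 1 k = 1 - X ^ (k + 1) := by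
    intro k
    have h := box_succ 0 k
    have h' := box_succ' 0 k
    simp only [zero_add, box_zero_left] at h h'
    linear_combination h - h'
  have hB : Nonneg (box 1 (l + 2) - (1 + X + X ^ 2)) := by
    have h2 : box 1 2 = 1 + X + X ^ 2 := by
      have h := box_succ 0 1
      have h' := box_succ 0 0
      simp only [zero_add, box_zero_left, box_zero_right] at h h'
      rw [h, h']; ring
    rw [← h2]; exact box_le_right 1 (by omega)
  have hG := (gdiff_le_box 2 l).trans (box_le_right 2 (Nat.le_succ l))
  have h₁ := (nonneg_box 1 (l + 2)).X_mul (2 * (l + 2))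
  have h₂ := (X_pow_mul_le_gdiff_two l).X_mul 1
  have h₃ := ((hB.sub_mul_left (nonneg_box 2 (l + 1))).add (hG.sub_mul_left hT)).X_mul (l + 5)
  have e := diffOne_sub_loss 0 l
  rw [zero_add] at e
  rw [e]
  convert ((h₁.add h₂).add h₃).X_mul ((0 + 3) * (0 + 4) + 2 * l + 0 + 6) using 1
  rw [box_zero_left, gdiff_two_succ, zero_add]
  linear_combination X ^ ((0 + 3) * (0 + 4) + 2 * l + 0 + 6)
    * X * (1 + X + X ^ 2) * (1 + X ^ 2 * gdiff 2 l) * hone (l + 1)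

theorem nonneg_diff_add_gain (j l : ℕ) :
    Nonneg (diffOne (j + 1) (l + 2) - lossTwo j (l + 1) - lossOne (j + 1) l
      + (gain (j + 1) l - lossThree j l)) := by
  rcases j with _ | i
  · convert (nonneg_diffOne_sub_loss_zero l).add (gain_sub_lossThree 0 l) using 1
    ring
  · convert (nonneg_diffOne_sub_loss_succ i l).add ((gain_sub_lossThree (i + 1) l).add
      (((nonneg_box (i + 1 + 1) (l + 2)).mul (nonneg_box (i + 1 + 2) (l + 1))).X_mul
        ((i + 1 + 4) * (i + 1 + 4) + 3 * l + (i + 1) + 7))) using 1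
    ring

theorem nonneg_diffOne (i k : ℕ) : Nonneg (diffOne i k) :=
  ((nonneg_box i k).mul (nonneg_gdiff i k)).X_mul _

theorem nonneg_diffOne_sub_lossTwo (j : ℕ) : Nonneg (diffOne (j + 1) 1 - lossTwo j 0) := by
  have h₁ : Nonneg (gdiff (j + 2) 1 - gdiff (j + 2) 0) := by
    rw [gdiff_add_two_sub j 0]; exact (nonneg_box j 1).X_mul _
  have h := (h₁.sub_mul_left (nonneg_box (j + 1) 1)).add (box_le_succ_left j 1)
  convert h.X_mul ((j + 3) * (j + 4) + 4 + j) using 1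
  rw [diffOne, lossTwo, gdiff_zero]; ring

theorem nonneg_gain_sub_lossOne :
    Nonneg ((ser fun i => diffOne (i + 1) 0) + ser (gain 0) - ser (lossOne 0)) := by
  have hU : (ser fun i => diffOne (i + 1) 0) = X ^ 14 + ser fun i => diffOne (i + 2) 0 := by
    rw [ser_eq_add (adm2_diffOne.succ_left.col 0)]
    refine congrArg₂ _ ?_ rfl
    rw [diffOne, box_zero_right, gdiff_zero]; ring
  have hV : ser (lossOne 0) = X ^ 14 + X ^ 15 * ser fun l => X ^ (2 * l + 1) * 1 := by
    rw [ser_eq_add (adm2_lossOne.row 0), ← ser_mul_left (adm_X_pow (fun l => by omega) _)]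
    refine congrArg₂ _ ?_ (congrArg ser (funext fun l => ?_))
    · rw [lossOne, gdiff_one, box_zero_left]; ring
    · rw [lossOne, gdiff_one, box_zero_left]; ring
  have hW : Nonneg (ser (gain 0) - X ^ 15 * ser fun l => X ^ (3 * l) * (1 + X + X ^ 2)) := by
    rw [← ser_mul_left (adm_X_pow (fun l => by omega) _)]
    refine nonneg_ser_sub fun l => ?_
    have hB : Nonneg (box 1 (l + 1) - (1 + X)) := by
      have h1 : box 1 1 = 1 + X := by
        have h := box_succ 0 0
        simp only [zero_add, box_zero_left, box_zero_right] at h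
        rw [h]; ring
      rw [← h1]; exact box_le_right 1 (by omega)
    have h_one_add : Nonneg (1 + X : ℤ⟦X⟧) := by simpa using Nonneg.one.add (Nonneg.pow_X 1)
    convert ((hB.sub_mul_left h_one_add).add (Nonneg.pow_X 1)).X_mul (3 * l + 15) using 1
    rw [gain, box_zero_left]; ring
  rw [hU, hV]
  convert (hW.add (nonneg_ser_sub_ser_X_pow.X_mul 15)).add
    (nonneg_ser fun i => nonneg_diffOne (i + 2) 0) using 1
  ring

theorem nonneg_crankSer_sub_rankSer_one : Nonneg (crankSer 1 - rankSer 1) := by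
  have hU : ser2 diffOne = ser (diffOne 0) + (ser fun i => diffOne (i + 1) 0)
      + (ser fun i => diffOne (i + 1) 1) + ser2 fun i k => diffOne (i + 1) (k + 2) := by
    rw [ser2_eq_row adm2_diffOne, ser2_eq_col adm2_diffOne.succ_left,
      ser2_eq_col adm2_diffOne.succ_left.succ_right]
    ring
  have h := crankSer_sub_rankSer 0
  rw [ser2_eq_posOne_add_posTwo, ser2_eq_negOne_add_negTwo] at h
  have h₁ := ser2_posOne_sub_negOne
  have h₂ := ser2_posTwo_sub_negTwo
  rw [hU] at h₁
  rw [ser2_eq_row adm2_gain, ser2_eq_row adm2_lossOne, ser2_eq_col adm2_lossTwo] at h₂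
  have c₁ := nonneg_ser2 nonneg_diff_add_gain
  have c₂ := nonneg_ser nonneg_diffOne_sub_lossTwo
  have c₃ : Nonneg (ser fun i => posTwo i 0) :=
    nonneg_ser fun i => ((nonneg_box _ _).mul (nonneg_box _ _)).X_mul _
  rw [ser2_add, ser2_sub, ser2_sub, ser2_sub] at c₁
  rw [ser_sub] at c₂
  convert ((((Nonneg.pow_X 1).add c₁).add c₂).add c₃).add
    ((nonneg_ser (nonneg_diffOne 0)).add nonneg_gain_sub_lossOne) using 1
  linear_combination h + h₁ + h₂

theorem nonneg_crankSer_sub_rankSer (m : ℕ) (hm : 1 ≤ m) :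
    Nonneg (crankSer m - rankSer m) := by
  obtain _ | _ | μ := m
  · omega
  · exact nonneg_crankSer_sub_rankSer_one
  · exact nonneg_crankSer_sub_rankSer_add_two μ

/-- The generating function of all partitions, decomposed by the `d` by `d + m` Durfee
rectangle. -/
noncomputable def durfee (m : ℕ) : ℤ⟦X⟧ :=
  ser fun d => X ^ (d * (d + m)) * (bdd d * bdd (d + m))

theorem adm_durfee (m : ℕ) : Adm fun d => X ^ (d * (d + m)) * (bdd d * bdd (d + m)) :=
  adm_X_pow (fun d => by nlinarith [Nat.zero_le (d * m), Nat.le_mul_self d]) _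

theorem durfee_succ (m : ℕ) : durfee m = durfee (m + 1) := by
  obtain ⟨b, hb⟩ : ∃ b : ℕ → ℤ⟦X⟧, b = fun d =>
    X ^ (d * (d + m)) * (1 - X ^ d) * (bdd d * bdd (d + m)) := ⟨_, rfl⟩
  have hadm : Adm b := by
    rw [hb]; exact fun d => Dvd.dvd.mul_right (Dvd.dvd.mul_right
      (pow_dvd_pow X (by nlinarith [Nat.zero_le (d * m), Nat.le_mul_self d])) _) _
  have h0 : b 0 = 0 := by simp [hb]
  have h := ser_telescope hadm
  rw [h0] at h
  rw [← sub_eq_zero, durfee, durfee, ← ser_sub, ← h]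
  refine congrArg ser (funext fun d => ?_)
  simp only [hb]
  have h1 : (1 - X ^ (d + 1)) * bdd (d + 1) = bdd d := by linear_combination bdd_succ d
  have h2 := bdd_succ (d + m)
  rw [show d + (m + 1) = d + m + 1 by ring, show d + 1 + m = d + m + 1 by ring,
    show X ^ ((d + 1) * (d + m + 1)) * (1 - X ^ (d + 1)) * (bdd (d + 1) * bdd (d + m + 1))
      = X ^ ((d + 1) * (d + m + 1)) * (((1 - X ^ (d + 1)) * bdd (d + 1)) * bdd (d + m + 1)) by ring,
    h1]
  linear_combination (-X ^ (d * (d + m))) * X ^ d * bdd d * h2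

theorem coeff_durfee (m n : ℕ) : coeff n (durfee m) = coeff n (bdd (n + 1)) := by
  have h : ∀ m, durfee m = durfee 0 := by
    intro m
    induction m with
    | zero => rfl
    | succ m ih => rw [← durfee_succ, ih]
  rw [h m, ← h (n + 1), durfee, ser_eq_add (adm_durfee _), map_add, coeff_ser]
  rw [Finset.sum_eq_zero fun d _ => ?_]
  · simp [bdd_zero]
  · rw [coeff_X_pow_mul', if_neg (by nlinarith)]

theorem crankSer_add (m : ℕ) : crankSer m + X ^ m * crankSer (m + 1) = X ^ m * durfee m := by
  have e : X ^ m * crankSer (m + 1)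
      = ser fun d => X ^ m * (X ^ (d * (d + m)) * ((1 - X ^ d) * (bdd d * bdd (d + m)))) := by
    rw [crankSer, ← ser_mul_left (adm_X_pow (fun d => by nlinarith) _), ser_eq_add
      (f := fun d => X ^ m * (X ^ (d * (d + m)) * ((1 - X ^ d) * (bdd d * bdd (d + m)))))]
    · simp only [pow_zero, sub_self, zero_mul, mul_zero, zero_add]
      refine congrArg ser (funext fun d => ?_)
      have h1 : (1 - X ^ (d + 1)) * bdd (d + 1) = bdd d := by linear_combination bdd_succ d
      rw [← h1, show d + (m + 1) = d + 1 + m by ring]; ring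
    · exact fun d => Dvd.dvd.mul_left (Dvd.dvd.mul_right
        (pow_dvd_pow X (by nlinarith [Nat.zero_le (d * m), Nat.le_mul_self d])) _) _
  rw [e, crankSer, ← ser_add, durfee, ← ser_mul_left (adm_durfee m)]
  refine congrArg ser (funext fun d => ?_)
  ring

theorem rankSer_sub_succ (m : ℕ) :
    rankSer m - rankSer (m + 1) = ser fun r => X ^ (m + 1 + 2 * r) * box (m + r) r := by
  have e : (ser fun r => X ^ (m + 1 + r) * (box (m + 1 + r) r - X ^ r * box (m + r) r))
      = rankSer (m + 1) := by
    rw [ser_eq_add (adm_X_pow (fun r => by omega) _), rankSer]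
    simp only [box_zero_right, pow_zero, mul_one, sub_self, mul_zero, zero_add]
    refine congrArg ser (funext fun r => ?_)
    rw [show m + 1 + (r + 1) = m + 1 + r + 1 by ring, box_succ' (m + 1 + r),
      show m + (r + 1) = m + 1 + r by ring, show m + 1 + 1 + r = m + 1 + r + 1 by ring]
    ring
  rw [← e, rankSer, ← ser_sub]
  refine congrArg ser (funext fun r => ?_)
  ring

theorem nonneg_rankSer_sub_succ (m : ℕ) : Nonneg (rankSer m - rankSer (m + 1)) := by
  rw [rankSer_sub_succ]
  exact nonneg_ser fun r => (nonneg_box _ _).X_mul _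

/-- The generating function of the partitions of rank at most `m + 1`. -/
noncomputable def rankLeSer (m : ℕ) : ℤ⟦X⟧ := ser fun r => X ^ r * box (m + r) r

theorem rankLeSer_add_rankSer_succ (m : ℕ) :
    rankLeSer m + rankSer (m + 2) = rankLeSer (m + 1) + rankSer (m + 3) := by
  have h := rankSer_sub_succ (m + 2)
  have e : rankLeSer (m + 1) - rankLeSer m
      = ser fun r => X ^ (m + 2 + 1 + 2 * r) * box (m + 2 + r) r := by
    have e' : rankLeSer (m + 1) - rankLeSer m
        = ser fun r => X ^ r * (box (m + 1 + r) r - box (m + r) r) := by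
      rw [rankLeSer, rankLeSer, ← ser_sub]
      refine congrArg ser (funext fun r => ?_)
      ring
    rw [e', ser_eq_add (adm_X_pow (fun r => le_rfl) _)]
    simp only [box_zero_right, sub_self, mul_zero, zero_add]
    refine congrArg ser (funext fun r => ?_)
    rw [show m + 1 + (r + 1) = m + 1 + r + 1 by ring, box_succ (m + 1 + r),
      show m + (r + 1) = m + 1 + r by ring, show m + 1 + r + 1 = m + 2 + r by ring]
    ring
  linear_combination h - e

theorem coeff_box_stable_left {p k n : ℕ} (h : n ≤ p) : coeff n (box p k) = coeff n (box n k) := by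
  rw [box_symm p, box_symm n, coeff_box_stable h]

theorem rankLeSer_add_rankSer (m : ℕ) : rankLeSer m + rankSer (m + 2) = durfee (m + 1) := by
  ext n
  have h : ∀ k, rankLeSer m + rankSer (m + 2) = rankLeSer (m + k) + rankSer (m + k + 2) := by
    intro k
    induction k with
    | zero => rfl
    | succ k ih => rw [ih, rankLeSer_add_rankSer_succ]; rfl
  rw [coeff_durfee, h n, map_add, rankSer, rankLeSer, coeff_ser, coeff_ser,
    Finset.sum_eq_zero (f := fun i => coeff n (X ^ (m + n + 2 + 1 + i) * box (m + n + 2 + 1 + i) i)),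
    add_zero, bdd_eq_ser, coeff_ser]
  · refine Finset.sum_congr rfl fun r hr => ?_
    simp only [Finset.mem_range] at hr
    rw [coeff_X_pow_mul', coeff_X_pow_mul', if_pos (by omega),
      coeff_box_stable_left (by omega), coeff_box_stable_left (p := n) (by omega)]
    split_ifs
    · rfl
    · omega
  · intro i _
    rw [coeff_X_pow_mul', if_neg (by omega)]

theorem nonneg_rankSer_sub_crankSer (m : ℕ) : Nonneg (rankSer m - crankSer (m + 1)) := by
  have h₁ := (nonneg_rankSer_sub_succ (m + 2)).trans
    (nonneg_crankSer_sub_rankSer (m + 2) (by omega))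
  have h₂ : rankSer m = X ^ (m + 1) * rankLeSer (m + 1) := by
    rw [rankSer, rankLeSer, ← ser_mul_left (adm_X_pow (fun r => le_rfl) _)]
    refine congrArg ser (funext fun r => ?_)
    ring
  have h₃ := rankLeSer_add_rankSer (m + 1)
  have h₄ := crankSer_add (m + 1)
  have h₅ := durfee_succ (m + 1)
  convert h₁.X_mul (m + 1) using 1
  rw [show m + 2 + 1 = m + 1 + 2 by ring]
  linear_combination h₂ + X ^ (m + 1) * h₃ - h₄ - X ^ (m + 1) * h₅

/-- The generating function of the partitions with `w` parts equal to `1` and `j` parts larger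
than `w`. -/
noncomputable def crankTerm (j w : ℕ) : ℤ⟦X⟧ := X ^ (j * w + j + w) * ((1 - X) * (bdd j * bdd w))

theorem ser_crankTerm (m : ℕ) :
    (ser fun j => crankTerm j (j + m)) = crankSer m - crankSer (m + 1) := by
  obtain ⟨b, hb⟩ : ∃ b : ℕ → ℤ⟦X⟧, b = fun j =>
    X ^ ((j + 1) * (j + m)) * (1 - X ^ j) * (bdd j * bdd (j + m)) := ⟨_, rfl⟩
  have hadm : Adm b := by
    rw [hb]; exact fun d => Dvd.dvd.mul_right (Dvd.dvd.mul_right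
      (pow_dvd_pow X (by nlinarith)) _) _
  have h0 : b 0 = 0 := by simp [hb]
  have h := ser_telescope hadm
  rw [h0] at h
  have e : (ser fun j => (X ^ ((j + 1) * (j + m)) * (bdd j * bdd (j + m))
      - X ^ ((j + 1) * (j + (m + 1))) * (bdd j * bdd (j + (m + 1)))) - crankTerm j (j + m))
      = ser fun j => b j - b (j + 1) := by
    refine congrArg ser (funext fun j => ?_)
    simp only [hb, crankTerm]
    have h1 : (1 - X ^ (j + 1)) * bdd (j + 1) = bdd j := by linear_combination bdd_succ j
    have h2 := bdd_succ (j + m)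
    rw [show j + (m + 1) = j + m + 1 by ring, show j + 1 + m = j + m + 1 by ring,
      show X ^ ((j + 1 + 1) * (j + m + 1)) * (1 - X ^ (j + 1)) * (bdd (j + 1) * bdd (j + m + 1))
        = X ^ ((j + 1 + 1) * (j + m + 1)) * (((1 - X ^ (j + 1)) * bdd (j + 1)) * bdd (j + m + 1))
        by ring, h1]
    linear_combination (-X ^ ((j + 1) * (j + m))) * X ^ (j + 1) * bdd j * h2
  rw [h, ser_sub, ser_sub] at e
  exact (sub_eq_zero.1 e).symm

theorem ser2_crankTerm (m : ℕ) :
    (ser2 fun c j => crankTerm j (j + (m + c))) = crankSer m := by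
  have hadm : Adm fun c => crankSer (m + c) := fun c =>
    X_pow_dvd_ser fun d => Dvd.dvd.mul_right (pow_dvd_pow X (by nlinarith)) _
  have h := ser_telescope hadm
  rw [ser2]
  simp only [ser_crankTerm]
  exact h

/-- The multisets of positive integers with sum `n`. -/
def positiveMultisets (n : ℕ) : Finset (Multiset ℕ) :=
  Finset.univ.image (Nat.Partition.parts (n := n))

theorem mem_positiveMultisets {n : ℕ} {s : Multiset ℕ} :
    s ∈ positiveMultisets n ↔ 0 ∉ s ∧ s.sum = n := by
  simp only [positiveMultisets, Finset.mem_image, Finset.mem_univ, true_and]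
  constructor
  · rintro ⟨l, rfl⟩
    exact ⟨fun h => (l.parts_pos h).ne rfl, l.parts_sum⟩
  · rintro ⟨h, hs⟩
    exact ⟨⟨s, fun {i} hi => Nat.pos_of_ne_zero fun h0 => h (h0 ▸ hi), hs⟩, rfl⟩

open Classical in
/-- The generating function of the multisets of positive integers satisfying `P`, by their sum. -/
noncomputable def gf (P : Multiset ℕ → Prop) : ℤ⟦X⟧ :=
  mk fun n => (((positiveMultisets n).filter P).card : ℤ)

open Classical in
theorem coeff_gf (P : Multiset ℕ → Prop) (n : ℕ) :
    coeff n (gf P) = (((positiveMultisets n).filter P).card : ℤ) := coeff_mk _ _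

theorem coeff_gf_congr {P Q : Multiset ℕ → Prop} {n : ℕ}
    (h : ∀ s, 0 ∉ s → s.sum = n → (P s ↔ Q s)) : coeff n (gf P) = coeff n (gf Q) := by
  classical
  rw [coeff_gf, coeff_gf]
  refine congrArg (fun t : Finset (Multiset ℕ) => (t.card : ℤ)) (Finset.filter_congr fun s hs => ?_)
  have := mem_positiveMultisets.1 hs
  exact h s this.1 this.2

theorem gf_congr {P Q : Multiset ℕ → Prop} (h : ∀ s, 0 ∉ s → (P s ↔ Q s)) : gf P = gf Q := by
  ext n; exact coeff_gf_congr fun s hs _ => h s hs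

theorem coeff_gf_eq_zero {P : Multiset ℕ → Prop} {n : ℕ} (h : ∀ s, 0 ∉ s → s.sum = n → ¬ P s) :
    coeff n (gf P) = 0 := by
  classical
  rw [coeff_gf, Finset.filter_false_of_mem, Finset.card_empty, Nat.cast_zero]
  intro s hs
  have := mem_positiveMultisets.1 hs
  exact h s this.1 this.2

theorem gf_eq_zero {P : Multiset ℕ → Prop} (h : ∀ s, 0 ∉ s → ¬ P s) : gf P = 0 := by
  ext n; rw [coeff_gf_eq_zero fun s hs _ => h s hs, map_zero]

theorem gf_eq_one {P : Multiset ℕ → Prop} (h : ∀ s, 0 ∉ s → (P s ↔ s = 0)) : gf P = 1 := by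
  ext n
  rw [coeff_gf, coeff_one]
  split_ifs with hn
  · rw [Nat.cast_eq_one, Finset.card_eq_one]
    refine ⟨0, ?_⟩
    ext s
    simp only [Finset.mem_filter, mem_positiveMultisets, Finset.mem_singleton, hn]
    constructor
    · rintro ⟨⟨h0, _⟩, hP⟩; exact (h s h0).1 hP
    · rintro rfl; exact ⟨⟨by simp, by simp⟩, (h 0 (by simp)).2 rfl⟩
  · rw [← coeff_gf]
    refine coeff_gf_eq_zero fun s h0 hs hP => hn ?_
    rw [← hs, (h s h0).1 hP, Multiset.sum_zero]

theorem gf_eq_cons {c : ℕ} (hc : 1 ≤ c) (P : Multiset ℕ → Prop) :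
    gf P = gf (fun s => P s ∧ c ∉ s) + X ^ c * gf fun s => P (c ::ₘ s) := by
  classical
  ext n
  rw [map_add, coeff_X_pow_mul', coeff_gf, coeff_gf,
    ← Finset.card_filter_add_card_filter_not (s := (positiveMultisets n).filter P) (fun s => c ∉ s),
    Nat.cast_add, Finset.filter_filter, Finset.filter_filter]
  refine congrArg₂ _ (by congr!) ?_
  split_ifs with hcn
  · rw [coeff_gf, Nat.cast_inj]
    refine Finset.card_nbij' (fun s => s.erase c) (fun s => c ::ₘ s) ?_ ?_ ?_ ?_
    · intro s hs
      simp only [Finset.coe_filter, mem_positiveMultisets, Set.mem_ofPred_eq, not_not] at hs ⊢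
      obtain ⟨⟨h0, hs⟩, hP, hcs⟩ := hs
      refine ⟨⟨fun h => h0 (Multiset.mem_of_mem_erase h), ?_⟩, by rwa [Multiset.cons_erase hcs]⟩
      have := Multiset.sum_erase hcs
      omega
    · intro s hs
      simp only [Finset.coe_filter, mem_positiveMultisets, Set.mem_ofPred_eq, not_not] at hs ⊢
      obtain ⟨⟨h0, hs⟩, hP⟩ := hs
      refine ⟨⟨?_, ?_⟩, hP, Multiset.mem_cons_self _ _⟩
      · rw [Multiset.mem_cons, not_or]; exact ⟨by omega, h0⟩
      · rw [Multiset.sum_cons]; omega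
    · intro s hs
      simp only [Finset.coe_filter, Set.mem_ofPred_eq, not_not] at hs
      exact Multiset.cons_erase hs.2.2
    · intro s _
      exact Multiset.erase_cons_head _ _
  · rw [Nat.cast_eq_zero, Finset.card_eq_zero, Finset.filter_eq_empty_iff]
    intro s hs h
    have := (mem_positiveMultisets.1 hs).2
    exact hcn (this ▸ Multiset.single_le_sum (fun _ _ => Nat.zero_le _) _ (not_not.1 h.2))

theorem filter_le_add_filter_lt (w : ℕ) (s : Multiset ℕ) :
    s.filter (· ≤ w) + s.filter (w < ·) = s := by
  simpa only [not_le] using Multiset.filter_add_not (· ≤ w) s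

theorem filter_add_of_le_of_lt {w : ℕ} {s t : Multiset ℕ} (hs : ∀ x ∈ s, x ≤ w)
    (ht : ∀ x ∈ t, w < x) :
    (s + t).filter (· ≤ w) = s ∧ (s + t).filter (w < ·) = t := by
  rw [Multiset.filter_add, Multiset.filter_add, Multiset.filter_eq_self.2 hs,
    Multiset.filter_eq_self.2 ht, Multiset.filter_eq_nil.2 fun x hx => not_le.2 (ht x hx),
    Multiset.filter_eq_nil.2 fun x hx => not_lt.2 (hs x hx), add_zero, zero_add]
  exact ⟨rfl, rfl⟩

theorem gf_mul (w : ℕ) (P Q : Multiset ℕ → Prop) :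
    gf (fun s => P (s.filter (· ≤ w)) ∧ Q (s.filter (w < ·)))
      = gf (fun s => P s ∧ ∀ x ∈ s, x ≤ w) * gf fun s => Q s ∧ ∀ x ∈ s, w < x := by
  classical
  ext n
  rw [coeff_mul, coeff_gf]
  simp only [coeff_gf, ← Nat.cast_mul, ← Nat.cast_sum, ← Finset.card_product, ← Finset.card_sigma]
  rw [Nat.cast_inj]
  refine Finset.card_nbij' (fun s => ⟨((s.filter (· ≤ w)).sum, (s.filter (w < ·)).sum),
    (s.filter (· ≤ w), s.filter (w < ·))⟩) (fun x => x.2.1 + x.2.2) ?_ ?_ ?_ ?_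
  · intro s hs
    simp only [Finset.coe_filter, mem_positiveMultisets, Set.mem_ofPred_eq] at hs
    simp only [Finset.mem_coe, Finset.mem_sigma, mem_antidiagonal,
      Finset.mem_product, Finset.mem_filter, mem_positiveMultisets, and_true, Multiset.mem_filter]
    refine ⟨?_, ⟨fun h => hs.1.1 h.1, hs.2.1, fun x h => h.2⟩,
      ⟨fun h => hs.1.1 h.1, hs.2.2, fun x h => h.2⟩⟩
    rw [← Multiset.sum_add, filter_le_add_filter_lt, hs.1.2]
  · rintro ⟨p, s, t⟩ hx
    simp only [Finset.mem_coe, Finset.mem_sigma, mem_antidiagonal,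
      Finset.mem_product, Finset.mem_filter, mem_positiveMultisets] at hx
    obtain ⟨hp, ⟨⟨hs0, hs⟩, hP, hsw⟩, ⟨ht0, ht⟩, hQ, htw⟩ := hx
    obtain ⟨e₁, e₂⟩ := filter_add_of_le_of_lt hsw htw
    simp only [Finset.coe_filter, mem_positiveMultisets, Set.mem_ofPred_eq, e₁, e₂]
    exact ⟨⟨by simp [hs0, ht0], by rw [Multiset.sum_add, hs, ht, hp]⟩, hP, hQ⟩
  · intro s _
    exact filter_le_add_filter_lt w s
  · rintro ⟨p, s, t⟩ hx
    simp only [Finset.mem_coe, Finset.mem_sigma, mem_antidiagonal,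
      Finset.mem_product, Finset.mem_filter, mem_positiveMultisets] at hx
    obtain ⟨hp, ⟨⟨hs0, hs⟩, hP, hsw⟩, ⟨ht0, ht⟩, hQ, htw⟩ := hx
    obtain ⟨e₁, e₂⟩ := filter_add_of_le_of_lt hsw htw
    simp only [e₁, e₂, hs, ht]

theorem card_le_sum {s : Multiset ℕ} (h0 : 0 ∉ s) : s.card ≤ s.sum := by
  have : s.card • 1 ≤ s.sum := Multiset.card_nsmul_le_sum fun x hx =>
    Nat.pos_of_ne_zero fun h => h0 (h ▸ hx)
  simpa using this

theorem gf_card_le_forall_le (p k : ℕ) :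
    gf (fun s => s.card ≤ k ∧ ∀ x ∈ s, x ≤ p) = box p k := by
  induction p generalizing k with
  | zero =>
    rw [box_zero_left]
    refine gf_eq_one fun s h0 => ⟨fun h => Multiset.eq_zero_of_forall_notMem fun x hx => h0 ?_, ?_⟩
    · rwa [← Nat.le_zero.1 (h.2 x hx)]
    · rintro rfl; simp
  | succ p ihp =>
    induction k with
    | zero =>
      rw [box_zero_right]
      refine gf_eq_one fun s h0 => ⟨fun h => Multiset.card_eq_zero.1 (Nat.le_zero.1 h.1), ?_⟩
      rintro rfl; simp
    | succ k ihk =>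
      rw [gf_eq_cons (c := p + 1) (by omega), box_succ, ← ihp, ← ihk]
      refine congrArg₂ _ (gf_congr fun s _ => ⟨?_, ?_⟩) (congrArg _ (gf_congr fun s _ => ?_))
      · rintro ⟨⟨h₁, h₂⟩, h₃⟩
        refine ⟨h₁, fun x hx => ?_⟩
        have : x ≠ p + 1 := fun h => h₃ (h ▸ hx)
        have := h₂ x hx
        omega
      · rintro ⟨h₁, h₂⟩
        exact ⟨⟨h₁, fun x hx => (h₂ x hx).trans (Nat.le_succ p)⟩,
          fun h => absurd (h₂ _ h) (by omega)⟩
      · simp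

theorem gf_forall_le (d : ℕ) : gf (fun s => ∀ x ∈ s, x ≤ d) = bdd d := by
  ext n
  rw [coeff_bdd le_rfl, ← gf_card_le_forall_le]
  exact coeff_gf_congr fun s h0 hs => ⟨fun h => ⟨hs ▸ card_le_sum h0, h⟩, fun h => h.2⟩

theorem gf_card_eq_forall_lt_le (a b k : ℕ) :
    gf (fun s => s.card = k ∧ ∀ x ∈ s, a < x ∧ x ≤ a + 1 + b) = X ^ (k * (a + 1)) * box b k := by
  have h0 : ∀ b, gf (fun s => s.card = 0 ∧ ∀ x ∈ s, a < x ∧ x ≤ a + 1 + b) = 1 := fun b =>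
    gf_eq_one fun s _ => ⟨fun h => Multiset.card_eq_zero.1 h.1, by rintro rfl; simp⟩
  induction b generalizing k with
  | zero =>
    induction k with
    | zero => rw [h0, box_zero_right, zero_mul, pow_zero, one_mul]
    | succ k ih =>
      rw [gf_eq_cons (c := a + 1) (by omega), gf_eq_zero, zero_add, box_zero_left, mul_one]
      · rw [box_zero_left, mul_one] at ih
        rw [add_mul, one_mul, pow_add _ _ (a + 1), mul_comm, mul_comm (X ^ (k * _)), ← ih, mul_comm]
        refine congrArg _ (gf_congr fun s _ => ?_)
        simp
      · rintro s - ⟨⟨h₁, h₂⟩, h₃⟩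
        obtain ⟨x, hx⟩ := Multiset.card_pos_iff_exists_mem.1 (show 0 < s.card by omega)
        have := h₂ x hx
        obtain rfl : x = a + 1 := by omega
        exact h₃ hx
  | succ b ihb =>
    induction k with
    | zero => rw [h0, box_zero_right, zero_mul, pow_zero, one_mul]
    | succ k ihk =>
      have e : X ^ ((k + 1) * (a + 1)) * box (b + 1) (k + 1)
          = X ^ ((k + 1) * (a + 1)) * box b (k + 1)
            + X ^ (a + 1 + (b + 1)) * (X ^ (k * (a + 1)) * box (b + 1) k) := by
        rw [box_succ]; ring
      rw [gf_eq_cons (c := a + 1 + (b + 1)) (by omega), e, ← ihb, ← ihk]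
      refine congrArg₂ _ (gf_congr fun s _ => ⟨?_, ?_⟩) (congrArg _ (gf_congr fun s _ => ?_))
      · rintro ⟨⟨h₁, h₂⟩, h₃⟩
        refine ⟨h₁, fun x hx => ?_⟩
        have : x ≠ a + 1 + (b + 1) := fun h => h₃ (h ▸ hx)
        have := h₂ x hx
        omega
      · rintro ⟨h₁, h₂⟩
        refine ⟨⟨h₁, fun x hx => ?_⟩, fun h => ?_⟩
        · have := h₂ x hx
          omega
        · have := h₂ _ h
          omega
      · simp [add_assoc]

theorem gf_card_eq_forall_lt (w j : ℕ) :
    gf (fun s => s.card = j ∧ ∀ x ∈ s, w < x) = X ^ (j * (w + 1)) * bdd j := by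
  ext n
  trans coeff n (X ^ (j * (w + 1)) * box n j)
  · rw [← gf_card_eq_forall_lt_le]
    refine coeff_gf_congr fun s _ hs => and_congr_right fun _ => forall₂_congr fun x hx => ?_
    have := Multiset.single_le_sum (fun _ _ => Nat.zero_le _) _ hx
    omega
  · rw [coeff_X_pow_mul', coeff_X_pow_mul', box_symm]
    split_ifs
    · rw [coeff_bdd (Nat.sub_le _ _)]
    · rfl

theorem gf_one_notMem_forall_le {w : ℕ} (hw : 1 ≤ w) :
    gf (fun s => 1 ∉ s ∧ ∀ x ∈ s, x ≤ w) = (1 - X) * bdd w := by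
  have h := gf_eq_cons le_rfl fun s => ∀ x ∈ s, x ≤ w
  have e : gf (fun s => ∀ x ∈ 1 ::ₘ s, x ≤ w) = gf fun s => ∀ x ∈ s, x ≤ w :=
    gf_congr fun s _ => by simp [hw]
  have e' : gf (fun s => (∀ x ∈ s, x ≤ w) ∧ 1 ∉ s) = gf fun s => 1 ∉ s ∧ ∀ x ∈ s, x ≤ w :=
    gf_congr fun s _ => and_comm
  rw [e, e', gf_forall_le] at h
  linear_combination -h

theorem gf_count_one_forall_le (k : ℕ) {w : ℕ} (hw : 1 ≤ w) :
    gf (fun s => s.count 1 = k ∧ ∀ x ∈ s, x ≤ w) = X ^ k * ((1 - X) * bdd w) := by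
  induction k with
  | zero => simp only [Multiset.count_eq_zero, pow_zero, one_mul, gf_one_notMem_forall_le hw]
  | succ k ih =>
    rw [gf_eq_cons le_rfl, gf_eq_zero, zero_add, pow_add, mul_comm (X ^ k), mul_assoc, pow_one,
      ← ih]
    · refine congrArg _ (gf_congr fun s _ => ?_)
      simp [hw]
    · rintro s - ⟨⟨h₁, -⟩, h₂⟩
      rw [Multiset.count_eq_zero.2 h₂] at h₁
      omega

/-- The number of parts larger than the number of parts equal to `1` if there are any such parts,
and the largest part otherwise. -/
def crankHead (s : Multiset ℕ) : ℕ :=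
  if s.count 1 = 0 then s.sup else (s.filter (s.count 1 < ·)).card

theorem sup_mem {s : Multiset ℕ} (h : s ≠ 0) : s.sup ∈ s := by
  induction s using Multiset.induction with
  | empty => exact absurd rfl h
  | cons a s ih =>
    rw [Multiset.sup_cons, Multiset.mem_cons]
    rcases le_total s.sup a with h' | h'
    · exact Or.inl (sup_eq_left.2 h')
    · by_cases hs : s = 0
      · subst hs; simp
      · rw [sup_eq_right.2 h']; exact Or.inr (ih hs)

theorem sup_eq_iff {s : Multiset ℕ} {L : ℕ} (hL : L ≠ 0) :
    s.sup = L ↔ L ∈ s ∧ ∀ x ∈ s, x ≤ L := by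
  constructor
  · rintro rfl
    exact ⟨sup_mem (by rintro rfl; simp at hL), fun x hx => Multiset.le_sup hx⟩
  · rintro ⟨h₁, h₂⟩
    exact le_antisymm (Multiset.sup_le.2 h₂) (Multiset.le_sup h₁)

theorem gf_sup_eq {L : ℕ} (hL : 1 ≤ L) (P : Multiset ℕ → Prop) :
    gf (fun s => s.sup = L ∧ P s) = X ^ L * gf fun s => P (L ::ₘ s) ∧ ∀ x ∈ s, x ≤ L := by
  rw [gf_eq_cons hL, gf_eq_zero, zero_add]
  · refine congrArg _ (gf_congr fun s _ => ?_)
    rw [sup_eq_iff (by omega)]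
    simp [and_comm]
  · rintro s - ⟨⟨h₁, -⟩, h₂⟩
    exact h₂ ((sup_eq_iff (by omega)).1 h₁).1

theorem crankTerm_comm (j w : ℕ) : crankTerm j w = crankTerm w j := by
  unfold crankTerm; ring

theorem coeff_gf_crankHead {n : ℕ} (hn : 2 ≤ n) (j w : ℕ) :
    coeff n (gf fun s => crankHead s = j ∧ s.count 1 = w) = coeff n (crankTerm j w) := by
  rcases Nat.eq_zero_or_pos w with rfl | hw
  · rcases Nat.lt_or_ge j 2 with hj | hj
    · trans 0
      · refine coeff_gf_eq_zero fun s h0 hs => ?_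
        rintro ⟨h₁, h₂⟩
        rw [crankHead, if_pos h₂] at h₁
        have hne : s ≠ 0 := by rintro rfl; simp at hs; omega
        have hm := sup_mem hne
        rw [h₁] at hm
        rw [Multiset.count_eq_zero] at h₂
        interval_cases j
        · exact h0 hm
        · exact h₂ hm
      · have h1 : (1 - X) * bdd 1 = 1 := by
          have := bdd_succ 0
          rw [bdd_zero] at this
          linear_combination this
        interval_cases j
        · simp [crankTerm, bdd_zero, coeff_X, coeff_one]; omega
        · simp [crankTerm, bdd_zero, h1, coeff_X]; omega
    · refine congrArg _ ?_
      trans gf (fun s => s.sup = j ∧ 1 ∉ s)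
      · refine gf_congr fun s _ => ?_
        rw [crankHead, ← Multiset.count_eq_zero]
        constructor
        · rintro ⟨h, h'⟩; exact ⟨by rwa [if_pos h'] at h, h'⟩
        · rintro ⟨h, h'⟩; exact ⟨by rwa [if_pos h'], h'⟩
      · rw [gf_sup_eq (by omega), crankTerm, bdd_zero, mul_one, ← gf_one_notMem_forall_le (by omega),
          mul_zero, zero_add, add_zero]
        refine congrArg _ (gf_congr fun s _ => and_congr_left fun _ => ?_)
        rw [Multiset.mem_cons, not_or]
        exact and_iff_right (by omega)
  · refine congrArg _ ?_
    trans gf (fun s => (s.filter (· ≤ w)).count 1 = w ∧ (s.filter (w < ·)).card = j)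
    · refine gf_congr fun s _ => ?_
      rw [crankHead, Multiset.count_filter_of_pos (by omega)]
      constructor
      · rintro ⟨h, h'⟩
        rw [h', if_neg (by omega)] at h
        exact ⟨h', h⟩
      · rintro ⟨h', h⟩
        rw [h', if_neg (by omega)]
        exact ⟨h, rfl⟩
    · rw [gf_mul w (fun s => s.count 1 = w) (fun s => s.card = j), gf_count_one_forall_le w hw,
        gf_card_eq_forall_lt, crankTerm]
      ring

theorem sup_le_sum (s : Multiset ℕ) : s.sup ≤ s.sum :=
  Multiset.sup_le.2 fun _ hx => Multiset.single_le_sum (fun _ _ => Nat.zero_le _) _ hx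

theorem crankHead_le_sum {s : Multiset ℕ} (h0 : 0 ∉ s) : crankHead s ≤ s.sum := by
  unfold crankHead
  split_ifs
  · exact sup_le_sum s
  · exact (Multiset.card_le_card (Multiset.filter_le _ _)).trans (card_le_sum h0)

theorem coeff_gf_eq_sum (P : Multiset ℕ → Prop) (v : Multiset ℕ → ℕ) {n : ℕ}
    (h : ∀ s, 0 ∉ s → s.sum = n → v s ≤ n) :
    coeff n (gf P) = ∑ i ∈ Finset.range (n + 1), coeff n (gf fun s => P s ∧ v s = i) := by
  classical
  simp only [coeff_gf, ← Nat.cast_sum]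
  rw [Nat.cast_inj, Finset.card_eq_sum_card_fiberwise (f := v) (t := Finset.range (n + 1))]
  · refine Finset.sum_congr rfl fun i _ => ?_
    rw [Finset.filter_filter]
    congr!
  · intro s hs
    simp only [Finset.coe_filter, mem_positiveMultisets, Set.mem_ofPred_eq] at hs
    have := h s hs.1.1 hs.1.2
    simp only [Finset.coe_range, Set.mem_Iio]
    omega

theorem coeff_gf_card_add_le_sup {n : ℕ} (hn : 1 ≤ n) (m : ℕ) :
    coeff n (gf fun s => s.card + m ≤ s.sup) = coeff n (rankSer m) := by
  rw [rankSer, coeff_ser, coeff_gf_eq_sum _ (fun s => s.sup - m - 1)]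
  · refine Finset.sum_congr rfl fun r _ => ?_
    rw [← gf_card_le_forall_le]
    trans coeff n (gf fun s => s.sup = m + 1 + r ∧ s.card + m ≤ m + 1 + r)
    · refine coeff_gf_congr fun s _ hs => ?_
      have : 0 < s.card := Multiset.card_pos.2 (by rintro rfl; simp at hs; omega)
      omega
    · rw [gf_sup_eq (by omega)]
      refine congrArg _ (congrArg _ (gf_congr fun s _ => and_congr_left fun _ => ?_))
      rw [Multiset.card_cons]
      omega
  · rintro s _ rfl
    have := sup_le_sum s
    omega

theorem coeff_gf_sup_add_le_card {n : ℕ} (hn : 1 ≤ n) (m : ℕ) :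
    coeff n (gf fun s => s.sup + m ≤ s.card) = coeff n (rankSer m) := by
  rw [rankSer, coeff_ser, coeff_gf_eq_sum _ (fun s => s.card - m - 1)]
  · refine Finset.sum_congr rfl fun r _ => ?_
    have e := gf_card_eq_forall_lt_le 0 r (m + 1 + r)
    rw [zero_add, mul_one] at e
    rw [box_symm, ← e]
    refine coeff_gf_congr fun s h0 hs => ?_
    have hne : s ≠ 0 := by rintro rfl; simp at hs; omega
    have h1 : 1 ≤ s.sup := Nat.pos_of_ne_zero fun h => h0 (h ▸ sup_mem hne)
    have h2 : (∀ x ∈ s, 0 < x ∧ x ≤ 1 + r) ↔ s.sup ≤ 1 + r := by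
      rw [Multiset.sup_le]
      exact forall₂_congr fun x hx => and_iff_right (Nat.pos_of_ne_zero fun h => h0 (h ▸ hx))
    rw [h2]
    omega
  · rintro s h0 rfl
    have := card_le_sum h0
    omega

theorem coeff_gf_count_add_le_crankHead {n : ℕ} (hn : 2 ≤ n) (m : ℕ) :
    coeff n (gf fun s => s.count 1 + m ≤ crankHead s) = coeff n (crankSer m) := by
  rw [← ser2_crankTerm, ser2, coeff_ser,
    coeff_gf_eq_sum _ (fun s => crankHead s - s.count 1 - m)]
  · refine Finset.sum_congr rfl fun c _ => ?_
    rw [coeff_ser, coeff_gf_eq_sum _ (fun s => s.count 1)]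
    · refine Finset.sum_congr rfl fun j _ => ?_
      rw [crankTerm_comm, ← coeff_gf_crankHead hn]
      exact coeff_gf_congr fun s _ _ => by omega
    · rintro s h0 rfl
      exact (Multiset.count_le_card 1 s).trans (card_le_sum h0)
  · rintro s h0 rfl
    have := crankHead_le_sum h0
    omega

theorem coeff_gf_crankHead_add_le_count {n : ℕ} (hn : 2 ≤ n) (m : ℕ) :
    coeff n (gf fun s => crankHead s + m ≤ s.count 1) = coeff n (crankSer m) := by
  rw [← ser2_crankTerm, ser2, coeff_ser,
    coeff_gf_eq_sum _ (fun s => s.count 1 - crankHead s - m)]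
  · refine Finset.sum_congr rfl fun c _ => ?_
    rw [coeff_ser, coeff_gf_eq_sum _ crankHead]
    · refine Finset.sum_congr rfl fun j _ => ?_
      rw [← coeff_gf_crankHead hn]
      exact coeff_gf_congr fun s _ _ => by omega
    · rintro s h0 rfl
      exact crankHead_le_sum h0
  · rintro s h0 rfl
    have := (Multiset.count_le_card 1 s).trans (card_le_sum h0)
    omega

theorem coeff_gf_eq_card {P : Multiset ℕ → Prop} {n : ℕ} {Q : n.Partition → Prop}
    [DecidablePred Q] (h : ∀ l, Q l ↔ P l.parts) :
    coeff n (gf P) = ((Finset.univ.filter Q).card : ℤ) := by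
  classical
  rw [coeff_gf, positiveMultisets, Finset.filter_image,
    Finset.card_image_of_injective _ fun _ _ h => Nat.Partition.ext h]
  exact congrArg (fun t : Finset n.Partition => (t.card : ℤ))
    (Finset.filter_congr fun l _ => (h l).symm)

end QSeries

theorem Fin.le_apply_iff_of_monotone {N : ℕ} {F : Fin N → ℤ} (hF : Monotone F) (t : ℤ) (i : Fin N) :
    t ≤ F i ↔ N - i ≤ (Finset.univ.filter fun j => t ≤ F j).card := by
  constructor
  · intro h
    rw [← Fin.card_Ici]
    refine Finset.card_le_card fun j hj => ?_
    simp only [Finset.mem_Ici, Finset.mem_filter, Finset.mem_univ, true_and] at hj ⊢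
    exact h.trans (hF hj)
  · contrapose!
    intro h
    refine lt_of_le_of_lt (Finset.card_le_card (t := Finset.Ioi i) fun j hj => ?_) ?_
    · simp only [Finset.mem_Ioi, Finset.mem_filter, Finset.mem_univ, true_and] at hj ⊢
      by_contra! hji
      have := hF hji
      omega
    · rw [Fin.card_Ioi]
      omega

theorem Fin.apply_le_iff_of_monotone {N : ℕ} {F : Fin N → ℤ} (hF : Monotone F) (t : ℤ) (i : Fin N) :
    F i ≤ t ↔ i + 1 ≤ (Finset.univ.filter fun j => F j ≤ t).card := by
  constructor
  · intro h
    rw [← Fin.card_Iic]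
    refine Finset.card_le_card fun j hj => ?_
    simp only [Finset.mem_Iic, Finset.mem_filter, Finset.mem_univ, true_and] at hj ⊢
    exact (hF hj).trans h
  · contrapose!
    intro h
    refine lt_of_le_of_lt (Finset.card_le_card (t := Finset.Iio i) fun j hj => ?_) ?_
    · simp only [Finset.mem_Iio, Finset.mem_filter, Finset.mem_univ, true_and] at hj ⊢
      by_contra! hji
      have := hF hji
      omega
    · rw [Fin.card_Iio]
      omega

theorem exists_equiv_of_card_filter_le {α : Type*} [Fintype α] (f g : α → ℤ)
    (h₁ : ∀ m : ℤ, 1 ≤ m →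
      (Finset.univ.filter fun a => m ≤ g a).card ≤ (Finset.univ.filter fun a => m ≤ f a).card)
    (h₂ : ∀ m : ℤ, 1 ≤ m →
      (Finset.univ.filter fun a => m ≤ f a).card ≤ (Finset.univ.filter fun a => m - 1 ≤ g a).card)
    (h₃ : ∀ m : ℤ, 1 ≤ m →
      (Finset.univ.filter fun a => g a ≤ -m).card ≤ (Finset.univ.filter fun a => f a ≤ -m).card)
    (h₄ : ∀ m : ℤ, 1 ≤ m →
      (Finset.univ.filter fun a => f a ≤ -m).card
        ≤ (Finset.univ.filter fun a => g a ≤ -(m - 1)).card) :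
    ∃ τ : α ≃ α, ∀ a,
      (f a = 0 → f a - g (τ a) = 0) ∧
      (0 < f a → f a - g (τ a) = 0 ∨ f a - g (τ a) = 1) ∧
      (f a < 0 → f a - g (τ a) = 0 ∨ f a - g (τ a) = -1) := by
  have sorted : ∀ u : α → ℤ, ∃ e : Fin (Fintype.card α) ≃ α, Monotone (u ∘ e) := fun u =>
    ⟨(Tuple.sort (u ∘ (Fintype.equivFin α).symm)).trans (Fintype.equivFin α).symm,
      Tuple.monotone_sort (u ∘ (Fintype.equivFin α).symm)⟩
  have card_comp : ∀ (e : Fin (Fintype.card α) ≃ α) (P : α → Prop) [DecidablePred P],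
      (Finset.univ.filter fun i => P (e i)).card = (Finset.univ.filter P).card := by
    intro e P _
    rw [← Finset.card_map e.toEmbedding, Finset.map_filter]
    simp
  obtain ⟨e, he⟩ := sorted f
  obtain ⟨e', he'⟩ := sorted g
  refine ⟨e.symm.trans e', fun a => ?_⟩
  obtain ⟨i, rfl⟩ := e.surjective a
  simp only [Equiv.trans_apply, Equiv.symm_apply_apply]
  have f₁ : ∀ t, t ≤ f (e i) ↔
      Fintype.card α - i ≤ (Finset.univ.filter fun a => t ≤ f a).card := fun t => by
    rw [← card_comp e]; exact Fin.le_apply_iff_of_monotone he t i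
  have f₂ : ∀ t, f (e i) ≤ t ↔
      (i : ℕ) + 1 ≤ (Finset.univ.filter fun a => f a ≤ t).card := fun t => by
    rw [← card_comp e]; exact Fin.apply_le_iff_of_monotone he t i
  have g₁ : ∀ t, t ≤ g (e' i) ↔
      Fintype.card α - i ≤ (Finset.univ.filter fun a => t ≤ g a).card := fun t => by
    rw [← card_comp e']; exact Fin.le_apply_iff_of_monotone he' t i
  have g₂ : ∀ t, g (e' i) ≤ t ↔
      (i : ℕ) + 1 ≤ (Finset.univ.filter fun a => g a ≤ t).card := fun t => by
    rw [← card_comp e']; exact Fin.apply_le_iff_of_monotone he' t i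
  have k₁ : ∀ m : ℤ, 1 ≤ m → m ≤ g (e' i) → m ≤ f (e i) := fun m hm h =>
    (f₁ m).2 (((g₁ m).1 h).trans (h₁ m hm))
  have k₂ : ∀ m : ℤ, 1 ≤ m → m ≤ f (e i) → m - 1 ≤ g (e' i) := fun m hm h =>
    (g₁ _).2 (((f₁ m).1 h).trans (h₂ m hm))
  have k₃ : ∀ m : ℤ, 1 ≤ m → g (e' i) ≤ -m → f (e i) ≤ -m := fun m hm h =>
    (f₂ _).2 (((g₂ _).1 h).trans (h₃ m hm))
  have k₄ : ∀ m : ℤ, 1 ≤ m → f (e i) ≤ -m → g (e' i) ≤ -(m - 1) := fun m hm h =>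
    (g₂ _).2 (((f₂ _).1 h).trans (h₄ m hm))
  have a₁ := k₁ (g (e' i))
  have a₂ := k₂ (f (e i))
  have a₃ := k₃ (-g (e' i))
  have a₄ := k₄ (-f (e i))
  omega

namespace RankCrank

theorem part_one {n : ℕ} (l : n.Partition) : part l 1 = l.parts.sup := by
  have hmem : ∀ x, x ∈ (l.parts.sort (· ≤ ·)).reverse ↔ x ∈ l.parts := by simp
  have hsort : (l.parts.sort (· ≤ ·)).reverse.Pairwise (fun a b => b ≤ a) :=
    List.pairwise_reverse.2 (Multiset.pairwise_sort l.parts (· ≤ ·))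
  unfold part
  cases h : (l.parts.sort (· ≤ ·)).reverse with
  | nil =>
    have : l.parts = 0 := Multiset.eq_zero_of_forall_notMem fun x hx => by
      have := (hmem x).2 hx
      simp [h] at this
    simp [this]
  | cons a t =>
    rw [h] at hmem hsort
    refine le_antisymm (Multiset.le_sup ((hmem a).1 List.mem_cons_self)) ?_
    refine Multiset.sup_le.2 fun x hx => ?_
    rcases List.mem_cons.1 ((hmem x).2 hx) with rfl | hx
    · exact le_rfl
    · exact List.rel_of_pairwise_cons hsort hx

theorem crank_eq {n : ℕ} (l : n.Partition) :
    crank l = QSeries.crankHead l.parts - l.parts.count 1 := by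
  unfold crank QSeries.crankHead
  split_ifs with h
  · rw [part_one, h, Nat.cast_zero, sub_zero]
  · rfl

open QSeries PowerSeries

theorem card_le_rank {n : ℕ} (hn : 1 ≤ n) (m : ℕ) :
    ((Finset.univ.filter fun l : n.Partition => (m : ℤ) ≤ rank l).card : ℤ)
      = coeff n (rankSer m) := by
  rw [← coeff_gf_card_add_le_sup hn]
  refine (coeff_gf_eq_card fun l => ?_).symm
  rw [rank, part_one]
  omega

theorem card_rank_le {n : ℕ} (hn : 1 ≤ n) (m : ℕ) :
    ((Finset.univ.filter fun l : n.Partition => rank l ≤ -(m : ℤ)).card : ℤ)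
      = coeff n (rankSer m) := by
  rw [← coeff_gf_sup_add_le_card hn]
  refine (coeff_gf_eq_card fun l => ?_).symm
  rw [rank, part_one]
  omega

theorem card_le_crank {n : ℕ} (hn : 2 ≤ n) (m : ℕ) :
    ((Finset.univ.filter fun l : n.Partition => (m : ℤ) ≤ crank l).card : ℤ)
      = coeff n (crankSer m) := by
  rw [← coeff_gf_count_add_le_crankHead hn]
  refine (coeff_gf_eq_card fun l => ?_).symm
  rw [crank_eq]
  omega

theorem card_crank_le {n : ℕ} (hn : 2 ≤ n) (m : ℕ) :
    ((Finset.univ.filter fun l : n.Partition => crank l ≤ -(m : ℤ)).card : ℤ)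
      = coeff n (crankSer m) := by
  rw [← coeff_gf_crankHead_add_le_count hn]
  refine (coeff_gf_eq_card fun l => ?_).symm
  rw [crank_eq]
  omega

theorem coeff_rankSer_le_coeff_crankSer (n m : ℕ) :
    coeff n (rankSer (m + 1)) ≤ coeff n (crankSer (m + 1)) := by
  have := nonneg_crankSer_sub_rankSer (m + 1) (Nat.le_add_left 1 m) n
  rwa [map_sub, sub_nonneg] at this

theorem coeff_crankSer_le_coeff_rankSer (n m : ℕ) :
    coeff n (crankSer (m + 1)) ≤ coeff n (rankSer m) := by
  have := nonneg_rankSer_sub_crankSer m n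
  rwa [map_sub, sub_nonneg] at this

theorem crank_sub_rank_of_one (l : Nat.Partition 1) : crank l - rank l = -1 ∧ crank l < 0 := by
  obtain rfl : l = Nat.Partition.indiscrete 1 := Subsingleton.elim _ _
  have h : (Nat.Partition.indiscrete 1).parts = {1} := rfl
  have hc : crank (Nat.Partition.indiscrete 1) = -1 := by
    rw [crank, h]; decide
  rw [hc, rank, part_one, h]
  simp

end RankCrank

open RankCrank in
/-- For every `n ≥ 1` there is a bijection `τ` on partitions of `n` such that
`crank λ - rank (τ λ)` is `0` if `crank λ = 0`, is `0` or `1` if `crank λ > 0`,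
and is `0` or `-1` if `crank λ < 0`. -/
theorem exists_nearly_preserving_bijection (n : ℕ) (hn : 1 ≤ n) :
    ∃ τ : n.Partition ≃ n.Partition, ∀ l : n.Partition,
      (crank l = 0 → crank l - rank (τ l) = 0) ∧
      (0 < crank l → crank l - rank (τ l) = 0 ∨ crank l - rank (τ l) = 1) ∧
      (crank l < 0 → crank l - rank (τ l) = 0 ∨ crank l - rank (τ l) = -1) := by
  rcases hn.eq_or_lt with rfl | hn
  · refine ⟨Equiv.refl _, fun l => ?_⟩
    have := crank_sub_rank_of_one l
    rw [Equiv.refl_apply]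
    omega
  · refine exists_equiv_of_card_filter_le crank rank ?_ ?_ ?_ ?_ <;> intro m hm <;>
      obtain ⟨k, rfl⟩ : ∃ k : ℕ, m = (k + 1 : ℕ) := ⟨(m - 1).toNat, by omega⟩ <;>
      (try rw [show ((k + 1 : ℕ) : ℤ) - 1 = (k : ℕ) by omega]) <;> rw [← Nat.cast_le (α := ℤ)]
    · rw [card_le_rank hn.le, card_le_crank hn]
      exact coeff_rankSer_le_coeff_crankSer n k
    · rw [card_le_rank hn.le, card_le_crank hn]
      exact coeff_crankSer_le_coeff_rankSer n k
    · rw [card_rank_le hn.le, card_crank_le hn]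
      exact coeff_rankSer_le_coeff_crankSer n k
    · rw [card_rank_le hn.le, card_crank_le hn]
      exact coeff_crankSer_le_coeff_rankSer n k
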